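/- arXiv:1112.2916 — 2 statements merged into one kernel-verified Lean document; each statement's English description precedes it below -/
import Mathlib

section
/- Let v₁, v₂, v₃ ∈ ℂ with v₁ + v₂ + v₃ = 0. The following are equivalent: (i) for every differential field extension L of ℂ(t), every differential subfield K of L, and every pair (y, x) ∈ L² satisfying the system S_IV(v₁,v₂,v₃): y' = 2xy − y² − 2ty + 2(v₁−v₂) and x' = 2xy − x² + 2tx + 2(v₁−v₃), either y and x are both algebraic over K, or y, x are algebraically independent over K; (ii) v₁ − v₂ ∉ ℤ, v₂ − v₃ ∉ ℤ, and v₃ − v₁ ∉ ℤ. (Corollary 3.11: the solution set of S_IV(v) is strongly minimal if and only if v does not lie in the exceptional set 𝒲.) -/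
namespace PainleveIV

open Polynomial

section LinearODE

variable {k : Type*} [Field k]

/-- Nonzero polynomials split off their powers of `X` and `1 + X`. -/
lemma exists_eq_X_pow_mul_one_add_X_pow_mul (p : k[X]) (hp : p ≠ 0) :
    ∃ (b a : ℕ) (q : k[X]), p = X ^ b * (1 + X) ^ a * q ∧ q.eval 0 ≠ 0 ∧ q.eval (-1) ≠ 0 := by
  obtain ⟨q, hq, hq0⟩ := Polynomial.exists_eq_pow_rootMultiplicity_mul_and_not_dvd p hp 0
  have hqne : q ≠ 0 := by
    rintro rfl
    exact hq0 (dvd_zero _)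
  obtain ⟨r, hr, hr0⟩ := Polynomial.exists_eq_pow_rootMultiplicity_mul_and_not_dvd q hqne (-1)
  refine ⟨p.rootMultiplicity 0, q.rootMultiplicity (-1), r, ?_, ?_, ?_⟩
  · conv_lhs => rw [hq, hr]
    simp only [map_zero, sub_zero, map_neg, map_one, sub_neg_eq_add]
    ring
  · intro h
    apply hq0
    rw [hr]
    exact Dvd.dvd.mul_left (dvd_iff_isRoot.2 h) _
  · intro h
    exact hr0 (dvd_iff_isRoot.2 h)

lemma exists_eq_C_mul_of_darboux [CharZero k] (m : ℕ) (p g : k[X]) (hp : p ≠ 0)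
    (hg : g.natDegree ≤ 1)
    (h : (m : k[X]) * (1 + 2 * X) * p - 3 * X * (1 + X) * derivative p = g * p) :
    ∃ (b a : ℕ) (c : k), c ≠ 0 ∧ p = C c * (X ^ b * (1 + X) ^ a) ∧
      g = (m : k[X]) * (1 + 2 * X) - 3 * (b : k[X]) * (1 + X) - 3 * (a : k[X]) * X := by
  obtain ⟨b, a, q, rfl, h0, h1⟩ := exists_eq_X_pow_mul_one_add_X_pow_mul p hp
  have hX : (1 + X : k[X]) ≠ 0 := by
    intro h
    have := congrArg (eval 0) h
    simp at this
  have hder : X * (1 + X) * derivative (X ^ b * (1 + X) ^ a * q) =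
      X ^ b * (1 + X) ^ a * ((b : k[X]) * (1 + X) * q + (a : k[X]) * X * q +
        X * (1 + X) * derivative q) := by
    have e1 : (X : k[X]) * derivative (X ^ b) = (b : k[X]) * X ^ b := by
      rcases b with _ | b
      · simp
      · simp only [derivative_X_pow]
        push_cast
        simp only [map_add, map_one, map_natCast]
        ring
    have e2 : (1 + X : k[X]) * derivative ((1 + X) ^ a) = (a : k[X]) * (1 + X) ^ a := by
      rcases a with _ | a
      · simp
      · simp only [derivative_pow]
        push_cast
        simp only [map_add, map_one, map_natCast, derivative_one, derivative_X]
        ring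
    simp only [derivative_mul]
    linear_combination (1 + X) ^ (a + 1) * q * e1 + X ^ (b + 1) * q * e2
  set γ : k[X] := (m : k[X]) * (1 + 2 * X) - 3 * (b : k[X]) * (1 + X) - 3 * (a : k[X]) * X - g
    with hγ
  have key : γ * q = 3 * (X * (1 + X) * derivative q) := by
    have hne : (X ^ b * (1 + X) ^ a : k[X]) ≠ 0 :=
      mul_ne_zero (pow_ne_zero _ X_ne_zero) (pow_ne_zero _ hX)
    apply mul_left_cancel₀ hne
    rw [hγ]
    linear_combination h + 3 * hder
  have hγdeg : γ.natDegree ≤ 1 := by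
    rw [hγ]
    refine (natDegree_sub_le _ _).trans (max_le ?_ hg)
    compute_degree
  have e0 : γ.eval 0 = 0 := by
    have := congrArg (eval 0) key
    simpa [h0] using this
  have e1 : γ.eval (-1) = 0 := by
    have := congrArg (eval (-1)) key
    simpa [h1] using this
  have hγ0 : γ = 0 := by
    rw [eq_X_add_C_of_natDegree_le_one hγdeg] at e0 e1 ⊢
    simp at e0 e1
    simp [e0] at e1
    simp [e0, e1]
  rw [hγ0, zero_mul] at key
  have hdq : derivative q = 0 := by
    have h3 : (3 : k[X]) ≠ 0 := by exact_mod_cast (by norm_num : (3 : ℕ) ≠ 0)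
    have := key.symm
    simpa [h3, hX] using this
  obtain ⟨c, rfl⟩ : ∃ c, q = C c := ⟨_, eq_C_of_derivative_eq_zero hdq⟩
  refine ⟨b, a, c, ?_, by ring, ?_⟩
  · rintro rfl
    simp at h0
  · rw [hγ] at hγ0
    linear_combination -hγ0

lemma exists_eq_mul_of_ode_X_pow [CharZero k] (r : ℤ) (hr : ¬ (3 : ℤ) ∣ r) (b a : ℕ) (η ρ : k[X])
    (h : (r : k[X]) * (1 + 2 * X) * η - 3 * X * (1 + X) * derivative η +
      (3 * (b : k[X]) * (1 + X) + 3 * (a : k[X]) * X) * η = ρ * (X ^ b * (1 + X) ^ a)) :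
    ∃ χ : k[X], η = X ^ b * χ ∧ (r : k[X]) * (1 + 2 * X) * χ - 3 * X * (1 + X) * derivative χ +
      (3 * (a : k[X]) * X) * χ = ρ * (1 + X) ^ a := by
  induction b generalizing η with
  | zero => exact ⟨η, by simp, by simpa using h⟩
  | succ b ih =>
    have e0 : η.eval 0 = 0 := by
      have h0 := congrArg (eval 0) h
      simp only [eval_add, eval_sub, eval_mul, eval_intCast, eval_one, eval_ofNat, eval_X,
        eval_natCast, eval_pow] at h0
      have hne : ((r + 3 * (b + 1) : ℤ) : k) ≠ 0 := by
        rw [Int.cast_ne_zero]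
        omega
      have : ((r + 3 * (b + 1) : ℤ) : k) * η.eval 0 = 0 := by
        push_cast at h0 ⊢
        simp at h0
        linear_combination h0
      exact (mul_eq_zero.1 this).resolve_left hne
    obtain ⟨η₁, rfl⟩ := X_dvd_iff.2 (by rwa [← coeff_zero_eq_eval_zero] at e0)
    obtain ⟨χ, rfl, hχ⟩ := ih η₁ (by
      apply mul_left_cancel₀ (X_ne_zero (R := k))
      simp only [derivative_mul, derivative_X] at h
      push_cast at h
      linear_combination h)
    exact ⟨χ, by ring, hχ⟩

lemma exists_eq_mul_of_ode_one_add_X_pow [CharZero k] (r : ℤ) (hr : ¬ (3 : ℤ) ∣ r) (a : ℕ)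
    (η ρ : k[X])
    (h : (r : k[X]) * (1 + 2 * X) * η - 3 * X * (1 + X) * derivative η +
      (3 * (a : k[X]) * X) * η = ρ * (1 + X) ^ a) :
    ∃ χ : k[X], η = (1 + X) ^ a * χ ∧
      (r : k[X]) * (1 + 2 * X) * χ - 3 * X * (1 + X) * derivative χ = ρ := by
  induction a generalizing η with
  | zero => exact ⟨η, by simp, by simpa using h⟩
  | succ a ih =>
    have e0 : η.eval (-1) = 0 := by
      have h0 := congrArg (eval (-1)) h
      simp only [eval_add, eval_sub, eval_mul, eval_intCast, eval_one, eval_ofNat, eval_X,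
        eval_natCast, eval_pow] at h0
      have hne : ((-r - 3 * (a + 1) : ℤ) : k) ≠ 0 := by
        rw [Int.cast_ne_zero]
        omega
      have : ((-r - 3 * (a + 1) : ℤ) : k) * η.eval (-1) = 0 := by
        push_cast at h0 ⊢
        simp at h0
        linear_combination h0
      exact (mul_eq_zero.1 this).resolve_left hne
    obtain ⟨η₁, rfl⟩ : (1 + X : k[X]) ∣ η := by
      have := dvd_iff_isRoot.2 e0
      rwa [map_neg, map_one, sub_neg_eq_add, add_comm] at this
    obtain ⟨χ, rfl, hχ⟩ := ih η₁ (by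
      have hX : (1 + X : k[X]) ≠ 0 := by
        intro h
        have := congrArg (eval 0) h
        simp at this
      apply mul_left_cancel₀ hX
      simp only [derivative_mul, derivative_add, derivative_one, derivative_X] at h
      push_cast at h
      linear_combination h)
    exact ⟨χ, by ring, hχ⟩

lemma exists_eq_mul_of_ode [CharZero k] (r : ℤ) (hr : ¬ (3 : ℤ) ∣ r) (b a : ℕ) (η ρ : k[X])
    (h : (r : k[X]) * (1 + 2 * X) * η - 3 * X * (1 + X) * derivative η +
      (3 * (b : k[X]) * (1 + X) + 3 * (a : k[X]) * X) * η = ρ * (X ^ b * (1 + X) ^ a)) :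
    ∃ χ : k[X], η = X ^ b * (1 + X) ^ a * χ ∧
      (r : k[X]) * (1 + 2 * X) * χ - 3 * X * (1 + X) * derivative χ = ρ := by
  obtain ⟨χ, rfl, hχ⟩ := exists_eq_mul_of_ode_X_pow r hr b a η ρ h
  obtain ⟨ψ, rfl, hψ⟩ := exists_eq_mul_of_ode_one_add_X_pow r hr a χ ρ hχ
  exact ⟨ψ, by ring, hψ⟩

lemma coeff_ode_succ (r : ℤ) (χ : k[X]) (n : ℕ) :
    ((r : k[X]) * (1 + 2 * X) * χ - 3 * X * (1 + X) * derivative χ).coeff (n + 1) =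
      r * (χ.coeff (n + 1) + 2 * χ.coeff n) - 3 * ((n + 1) * χ.coeff (n + 1) + n * χ.coeff n) := by
  have : (r : k[X]) * (1 + 2 * X) * χ - 3 * X * (1 + X) * derivative χ =
      C (r : k) * (χ + C 2 * (X * χ)) - C 3 * (X * (derivative χ + X * derivative χ)) := by
    simp only [map_intCast, map_ofNat]
    ring
  rw [this]
  simp only [coeff_sub, coeff_C_mul, coeff_add, coeff_X_mul, coeff_derivative]
  rcases n with _ | n
  · simp
  · simp only [coeff_X_mul, coeff_derivative]
    push_cast
    ring

lemma coeff_ode_zero (r : ℤ) (χ : k[X]) :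
    ((r : k[X]) * (1 + 2 * X) * χ - 3 * X * (1 + X) * derivative χ).coeff 0 =
      r * χ.coeff 0 := by
  simp [coeff_zero_eq_eval_zero]

lemma eq_zero_of_ode_const [CharZero k] (g : k) (χ : k[X])
    (h : (((-1 : ℤ) : k[X])) * (1 + 2 * X) * χ - 3 * X * (1 + X) * derivative χ = C g) :
    χ = 0 ∧ g = 0 := by
  have hχ : χ = 0 := by
    by_contra hne
    have h1 := coeff_ode_succ (-1) χ χ.natDegree
    rw [h, coeff_C_of_ne_zero (Nat.succ_ne_zero _),
      coeff_eq_zero_of_natDegree_lt (Nat.lt_succ_self _)] at h1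
    have h2 : ((2 + 3 * χ.natDegree : ℕ) : k) * χ.coeff χ.natDegree = 0 := by
      push_cast at h1 ⊢
      linear_combination h1
    rcases mul_eq_zero.1 h2 with h3 | h3
    · rw [Nat.cast_eq_zero] at h3
      omega
    · exact hne (leadingCoeff_eq_zero.1 h3)
  refine ⟨hχ, ?_⟩
  rw [hχ] at h
  simpa using h.symm

lemma add_eq_zero_of_ode_quadratic [CharZero k] (p q s : k) (χ : k[X])
    (h : (((1 : ℤ) : k[X])) * (1 + 2 * X) * χ - 3 * X * (1 + X) * derivative χ =
      C p * X - C q * (X * (1 + X)) - C s * (1 + X)) :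
    p + q + s = 0 := by
  have hρ : (C p * X - C q * (X * (1 + X)) - C s * (1 + X) : k[X]) =
      C (-q) * X ^ 2 + C (p - q - s) * X + C (-s) := by
    simp only [map_sub, map_neg]
    ring
  rw [hρ] at h
  have hdeg : χ.natDegree ≤ 1 := by
    by_contra! hlt
    have h1 := coeff_ode_succ 1 χ χ.natDegree
    rw [h, coeff_eq_zero_of_natDegree_lt (Nat.lt_succ_self _),
      coeff_eq_zero_of_natDegree_lt (lt_of_le_of_lt natDegree_quadratic_le (by omega))] at h1
    have h2 : ((2 - 3 * χ.natDegree : ℤ) : k) * χ.coeff χ.natDegree = 0 := by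
      push_cast at h1 ⊢
      linear_combination -h1
    rcases mul_eq_zero.1 h2 with h3 | h3
    · rw [Int.cast_eq_zero] at h3
      omega
    · rw [leadingCoeff_eq_zero.1 h3] at hlt
      simp at hlt
  have c0 := coeff_ode_zero 1 χ
  have c1 := coeff_ode_succ 1 χ 0
  have c2 := coeff_ode_succ 1 χ 1
  have hc2 : χ.coeff 2 = 0 := coeff_eq_zero_of_natDegree_lt (by omega)
  rw [h] at c0 c1 c2
  simp [hc2, coeff_X, coeff_C] at c0 c1 c2
  linear_combination c1 - 2 * c0 - 2 * c2

end LinearODE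

end PainleveIV

namespace PainleveIV

open Polynomial

section Derivations

variable {R A : Type*} [CommRing R] [CommRing A] [Algebra R A]

/-- The derivation of `A[X]` that applies `d` to every coefficient. -/
noncomputable def coeffDer (d : Derivation R A A) : Derivation R A[X] A[X] :=
  PolynomialModule.equivPolynomialSelf.compDer d.mapCoeffs

@[simp]
lemma coeff_coeffDer (d : Derivation R A A) (p : A[X]) (n : ℕ) :
    (coeffDer d p).coeff n = d (p.coeff n) := rfl

@[simp]
lemma coeffDer_C (d : Derivation R A A) (a : A) : coeffDer d (C a) = C (d a) := by
  ext n
  rcases n with _ | n <;> simp [coeff_C]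

@[simp]
lemma coeffDer_X (d : Derivation R A A) : coeffDer d X = 0 := by
  ext n
  simp only [coeff_coeffDer, coeff_X, coeff_zero]
  split_ifs <;> simp

lemma natDegree_coeffDer_le (d : Derivation R A A) (p : A[X]) :
    (coeffDer d p).natDegree ≤ p.natDegree := by
  refine natDegree_le_iff_coeff_eq_zero.2 fun n hn ↦ ?_
  rw [coeff_coeffDer, coeff_eq_zero_of_natDegree_lt hn, map_zero]

/-- The derivation of `A[X]` given by the formal derivative. -/
noncomputable def formalDer (R A : Type*) [CommRing R] [CommRing A] [Algebra R A] :
    Derivation R A[X] A[X] :=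
  (derivative' : Derivation A A[X] A[X]).restrictScalars R

@[simp]
lemma formalDer_apply (p : A[X]) : formalDer R A p = derivative p := rfl

/-- The derivation of `A[X][X]` acting as `u • d` on `A`, with value `P` at the inner variable
and `Q` at the outer variable. -/
noncomputable def biDer (d : Derivation R A A) (u P Q : A[X][X]) : Derivation R A[X][X] A[X][X] :=
  u • coeffDer (coeffDer d) + P • coeffDer (formalDer R A) + Q • formalDer R A[X]

lemma biDer_apply (d : Derivation R A A) (u P Q F : A[X][X]) :
    biDer d u P Q F =
      u * coeffDer (coeffDer d) F + P * coeffDer (formalDer R A) F + Q * derivative F := rfl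

@[simp]
lemma biDer_C_C (d : Derivation R A A) (u P Q : A[X][X]) (a : A) :
    biDer d u P Q (C (C a)) = u * C (C (d a)) := by
  simp [biDer_apply]

@[simp]
lemma biDer_C_X (d : Derivation R A A) (u P Q : A[X][X]) : biDer d u P Q (C X) = P := by
  simp [biDer_apply]

@[simp]
lemma biDer_X (d : Derivation R A A) (u P Q : A[X][X]) : biDer d u P Q X = Q := by
  simp [biDer_apply]

lemma bivariate_induction {p : A[X][X] → Prop} (hC : ∀ a, p (C (C a))) (hY : p (C X)) (hX : p X)
    (hadd : ∀ F G, p F → p G → p (F + G)) (hmul : ∀ F G, p F → p G → p (F * G)) (F : A[X][X]) :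
    p F := by
  have hpow (G : A[X][X]) (hG : p G) (n : ℕ) : p (G ^ n) := by
    induction n with
    | zero => simpa using hC 1
    | succ n ih => exact pow_succ G n ▸ hmul _ _ ih hG
  have hinner (f : A[X]) : p (C f) := by
    induction f using Polynomial.induction_on' with
    | add f g hf hg => exact C_add (a := f) ▸ hadd _ _ hf hg
    | monomial n a =>
      rw [← C_mul_X_pow_eq_monomial, C_mul, C_pow]
      exact hmul _ _ (hC a) (hpow _ hY n)
  induction F using Polynomial.induction_on' with
  | add F G hF hG => exact hadd _ _ hF hG
  | monomial n f =>
    rw [← C_mul_X_pow_eq_monomial]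
    exact hmul _ _ (hinner f) (hpow _ hX n)

/-- The substitution `(f₁, f₂) = (s, s z)`: on the source the inner variable is `f₁` and the outer
variable is `f₂`; on the target the inner variable is `z` and the outer variable is `s`. -/
noncomputable def blowUp (A : Type*) [CommRing A] : A[X][X] →+* A[X][X] :=
  eval₂RingHom (eval₂RingHom (C.comp C) X) (C X * X)

@[simp]
lemma blowUp_C_C (a : A) : blowUp A (C (C a)) = C (C a) := by simp [blowUp]

@[simp]
lemma blowUp_C_X : blowUp A (C X) = X := by simp [blowUp]

@[simp]
lemma blowUp_X : blowUp A X = C X * X := by simp [blowUp]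

lemma coeff_coeff_blowUp (F : A[X][X]) (n b : ℕ) :
    ((blowUp A F).coeff n).coeff b = if b ≤ n then (F.coeff b).coeff (n - b) else 0 := by
  induction F using Polynomial.induction_on' with
  | add F G hF hG =>
    simp only [map_add, coeff_add, hF, hG]
    split_ifs <;> simp
  | monomial l f =>
    induction f using Polynomial.induction_on' with
    | add f g hf hg =>
      simp only [map_add, coeff_add, hf, hg]
      split_ifs <;> simp
    | monomial e a =>
      have : blowUp A (monomial l (monomial e a)) = monomial (e + l) (monomial l a) := by
        rw [← C_mul_X_pow_eq_monomial, ← C_mul_X_pow_eq_monomial, C_mul, C_pow]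
        simp only [map_mul, map_pow, blowUp_C_C, blowUp_C_X, blowUp_X]
        rw [← C_mul_X_pow_eq_monomial, ← C_mul_X_pow_eq_monomial, C_mul, C_pow]
        ring
      rw [this]
      simp only [coeff_monomial]
      by_cases h1 : l = b
      · subst h1
        by_cases h2 : l ≤ n
        · by_cases h3 : e + l = n
          · simp [h2, show e = n - l by omega]
          · simp [h2, h3, coeff_monomial, show e ≠ n - l by omega]
        · simp [h2, show e + l ≠ n by omega]
      · by_cases h3 : e + l = n
        · simp [h1, h3, coeff_monomial]
        · simp [h1, h3]

lemma natDegree_coeff_blowUp_le (F : A[X][X]) (n : ℕ) : ((blowUp A F).coeff n).natDegree ≤ n := by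
  refine natDegree_le_iff_coeff_eq_zero.2 fun b hb ↦ ?_
  rw [coeff_coeff_blowUp, if_neg (by omega)]

lemma eq_C_C_of_natDegree_blowUp_eq_zero (F : A[X][X]) (h : (blowUp A F).natDegree = 0) :
    F = C (C ((F.coeff 0).coeff 0)) := by
  ext b e
  by_cases hbe : e + b = 0
  · obtain ⟨rfl, rfl⟩ : e = 0 ∧ b = 0 := by omega
    simp
  · have h1 := coeff_coeff_blowUp F (e + b) b
    rw [coeff_eq_zero_of_natDegree_lt (n := e + b) (by omega), coeff_zero, if_pos (by omega),
      Nat.add_sub_cancel] at h1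
    rw [← h1]
    simp only [coeff_C]
    split_ifs with h2
    · rw [coeff_C, if_neg (by omega)]
    · simp

/-- The fourth Painlevé vector field in the coordinates `(f₁, f₂)`. -/
noncomputable def fieldDer (d : Derivation R A A) (t a₁ a₂ : A) : Derivation R A[X][X] A[X][X] :=
  biDer d 1 (C X * (C (C 2) * X + C X - C (C 2) * C (C t)) + C (C a₁))
    (X * (C (C 2) * C (C t) - C (C 2) * C X - X) + C (C a₂))

/-- The fourth Painlevé vector field in the coordinates `(z, s) = (f₂ / f₁, f₁)`,
multiplied by `s`. -/
noncomputable def chartDer (d : Derivation R A A) (t a₁ a₂ : A) : Derivation R A[X][X] A[X][X] :=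
  biDer d X (C (-C 3 * X * (1 + X)) * X ^ 2 + C (C 4 * C t * X) * X + C (C a₂ - C a₁ * X))
    (X * (C (1 + C 2 * X) * X ^ 2 + C (-C 2 * C t) * X + C (C a₁)))

lemma chartDer_blowUp (d : Derivation R A A) (t a₁ a₂ : A) (F : A[X][X]) :
    chartDer d t a₁ a₂ (blowUp A F) = X * blowUp A (fieldDer d t a₁ a₂ F) := by
  induction F using bivariate_induction with
  | hC a => simp [chartDer, fieldDer]
  | hY =>
    simp only [chartDer, fieldDer, biDer_X, biDer_C_X, blowUp_X, blowUp_C_X, blowUp_C_C, map_mul,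
      map_add, map_sub, map_neg, map_one]
    simp only [map_ofNat]
    ring
  | hX =>
    simp only [chartDer, fieldDer, biDer_X, biDer_C_X, blowUp_X, blowUp_C_X, blowUp_C_C, map_mul,
      map_add, map_sub, map_neg, map_one, Derivation.leibniz, smul_eq_mul]
    simp only [map_ofNat]
    ring
  | hadd F G hF hG =>
    simp only [map_add, hF, hG]
    ring
  | hmul F G hF hG =>
    simp only [map_mul, Derivation.leibniz, hF, hG, smul_eq_mul, map_add]
    ring

lemma natDegree_X_mul_derivative_le (H : A[X]) {n : ℕ} (hH : H.natDegree ≤ n) :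
    (X * derivative H).natDegree ≤ n := by
  refine natDegree_le_iff_coeff_eq_zero.2 fun b hb ↦ ?_
  rcases b with _ | b
  · simp
  · rw [coeff_X_mul, coeff_derivative, coeff_eq_zero_of_natDegree_lt (by omega), zero_mul]

lemma coeff_X_mul_derivative (H : A[X]) (n : ℕ) : (X * derivative H).coeff n = n * H.coeff n := by
  rcases n with _ | n
  · simp
  · rw [coeff_X_mul, coeff_derivative]
    push_cast
    ring

lemma chartDer_eq (d : Derivation R A A) (t a₁ a₂ : A) (H : A[X][X]) :
    chartDer d t a₁ a₂ H = X * coeffDer (coeffDer d) H +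
      (C (-C 3 * X * (1 + X)) * X ^ 2 + C (C 4 * C t * X) * X + C (C a₂ - C a₁ * X)) *
        coeffDer (formalDer R A) H +
      (C (1 + C 2 * X) * X ^ 2 + C (-C 2 * C t) * X + C (C a₁)) * (X * derivative H) := by
  rw [chartDer, biDer_apply]
  ring

lemma natDegree_chartDer_le (d : Derivation R A A) (t a₁ a₂ : A) (H : A[X][X]) {n : ℕ}
    (hH : H.natDegree ≤ n) : (chartDer d t a₁ a₂ H).natDegree ≤ 2 + n := by
  rw [chartDer_eq]
  refine natDegree_add_le_of_degree_le (natDegree_add_le_of_degree_le ?_ ?_) ?_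
  · exact natDegree_mul_le_of_le (natDegree_X_le.trans one_le_two)
      ((natDegree_coeffDer_le _ _).trans hH)
  · exact natDegree_mul_le_of_le natDegree_quadratic_le ((natDegree_coeffDer_le _ _).trans hH)
  · exact natDegree_mul_le_of_le natDegree_quadratic_le (natDegree_X_mul_derivative_le H hH)

lemma coeff_quadratic_mul (p q r : A) (H : A[X]) {n : ℕ} (hH : H.natDegree ≤ n) :
    ((C p * X ^ 2 + C q * X + C r) * H).coeff (2 + n) = p * H.coeff n := by
  rw [coeff_mul_add_eq_of_natDegree_le natDegree_quadratic_le hH]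
  simp

lemma coeff_chartDer (d : Derivation R A A) (t a₁ a₂ : A) (H : A[X][X]) {n : ℕ}
    (hH : H.natDegree ≤ n) : (chartDer d t a₁ a₂ H).coeff (2 + n) =
      (n : A[X]) * (1 + 2 * X) * H.coeff n - 3 * X * (1 + X) * derivative (H.coeff n) := by
  rw [chartDer_eq, coeff_add, coeff_add,
    coeff_quadratic_mul _ _ _ _ ((natDegree_coeffDer_le _ _).trans hH),
    coeff_quadratic_mul _ _ _ _ (natDegree_X_mul_derivative_le H hH), coeff_X_mul_derivative,
    show 2 + n = (n + 1) + 1 by ring, coeff_X_mul, coeff_coeffDer, coeff_coeffDer, formalDer_apply,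
    coeff_eq_zero_of_natDegree_lt (Nat.lt_succ_of_le hH), map_zero]
  simp only [map_ofNat]
  ring

end Derivations

end PainleveIV

namespace PainleveIV

open Polynomial

section InvariantCurves

variable {R k : Type*} [CommRing R] [Field k] [Algebra R k]

lemma mul_derivation_pow {A : Type*} [CommRing A] [Algebra R A] (δ : Derivation R A A) (e : A)
    (n : ℕ) : e * δ (e ^ n) = n * e ^ n * δ e := by
  rcases n with _ | n
  · simp
  · rw [Derivation.leibniz_pow, smul_eq_mul, nsmul_eq_mul, Nat.add_sub_cancel]
    ring

/-- The product of powers of the three linear forms `-f₀ = f₁ + f₂ - 2t`, `f₁`, `f₂`. -/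
noncomputable def linearProduct (t : k) (a j b : ℕ) : k[X][X] :=
  (C X + X - C (C (2 * t))) ^ a * C X ^ j * X ^ b

/-- The remainder in the logarithmic derivative of `linearProduct`, with denominators cleared. -/
noncomputable def linearRemainder (t a₁ a₂ : k) (a j b : ℕ) : k[X][X] :=
  C (C (j * a₁)) * (C X + X - C (C (2 * t))) * X + C (C (b * a₂)) * (C X + X - C (C (2 * t))) * C X
    - C (C (a * (2 - a₁ - a₂))) * C X * X

lemma fieldDer_linearProduct (d : Derivation R k k) (t a₁ a₂ : k) (ht : d t = 1) (a j b : ℕ) :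
    linearProduct t 1 1 1 * fieldDer d t a₁ a₂ (linearProduct t a j b) =
      (linearProduct t 1 1 1 * ((a : k[X][X]) * (C X - X) +
        (j : k[X][X]) * (C (C 2) * X + C X - C (C 2) * C (C t)) +
        (b : k[X][X]) * (C (C 2) * C (C t) - C (C 2) * C X - X)) +
        linearRemainder t a₁ a₂ a j b) * linearProduct t a j b := by
  have h0 := mul_derivation_pow (fieldDer d t a₁ a₂) (C X + X - C (C (2 * t))) a
  have h1 := mul_derivation_pow (fieldDer d t a₁ a₂) (C X) j
  have h2 := mul_derivation_pow (fieldDer d t a₁ a₂) X b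
  have v2 : d (2 * t) = 2 := by
    rw [show (2 : k) * t = t + t by ring, map_add, ht]
    norm_num
  have e0 : fieldDer d t a₁ a₂ (C X + X - C (C (2 * t))) =
      (C X + X - C (C (2 * t))) * (C X - X) - C (C (2 - a₁ - a₂)) := by
    simp only [fieldDer, map_add, map_sub, biDer_C_C, biDer_C_X, biDer_X, v2]
    simp only [map_mul]
    ring
  have e1 : fieldDer d t a₁ a₂ (C X) =
      C X * (C (C 2) * X + C X - C (C 2) * C (C t)) + C (C a₁) := by
    simp [fieldDer]
  have e2 : fieldDer d t a₁ a₂ X =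
      X * (C (C 2) * C (C t) - C (C 2) * C X - X) + C (C a₂) := by
    simp [fieldDer]
  rw [e0] at h0
  rw [e1] at h1
  rw [e2] at h2
  simp only [linearProduct, linearRemainder, Derivation.leibniz, smul_eq_mul, pow_one, map_mul,
    map_natCast] at h0 ⊢
  set e := (C X + X - C (C 2) * C (C t) : k[X][X])
  linear_combination (C X * C X ^ j * X * X ^ b) * h0 + (e * e ^ a * X * X ^ b) * h1 +
    (e * e ^ a * C X * C X ^ j) * h2

lemma blowUp_linearForm (t : k) : blowUp k (C X + X - C (C (2 * t))) =
    C (1 + X) * X + C (-C (2 * t)) := by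
  simp only [map_add, map_sub, blowUp_C_X, blowUp_X, blowUp_C_C, map_one, map_neg]
  ring

lemma natDegree_blowUp_linearProduct_le (t : k) (a j b : ℕ) :
    (blowUp k (linearProduct t a j b)).natDegree ≤ a + j + b := by
  have h0 : (blowUp k ((C X + X - C (C (2 * t))) ^ a)).natDegree ≤ a * 1 := by
    rw [map_pow, blowUp_linearForm]
    exact natDegree_pow_le_of_le _ natDegree_linear_le
  have h1 : (blowUp k (C X ^ j)).natDegree ≤ j * 1 := by
    rw [map_pow, blowUp_C_X]
    exact natDegree_pow_le_of_le _ natDegree_X_le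
  have h2 : (blowUp k (X ^ b)).natDegree ≤ b * 1 := by
    rw [map_pow, blowUp_X]
    exact natDegree_pow_le_of_le _ ((natDegree_C_mul_le _ _).trans natDegree_X_le)
  rw [mul_one] at h0 h1 h2
  rw [linearProduct, map_mul, map_mul]
  exact natDegree_mul_le_of_le (natDegree_mul_le_of_le h0 h1) h2

lemma coeff_blowUp_linearProduct (t : k) (a j b : ℕ) :
    (blowUp k (linearProduct t a j b)).coeff (a + j + b) = X ^ b * (1 + X) ^ a := by
  have h0 : (blowUp k ((C X + X - C (C (2 * t))) ^ a)).natDegree ≤ a * 1 := by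
    rw [map_pow, blowUp_linearForm]
    exact natDegree_pow_le_of_le _ natDegree_linear_le
  have e0 : (blowUp k ((C X + X - C (C (2 * t))) ^ a)).coeff (a * 1) = (1 + X) ^ a := by
    rw [map_pow, blowUp_linearForm, coeff_pow_of_natDegree_le natDegree_linear_le]
    simp
  rw [mul_one] at h0 e0
  have h1 : blowUp k (C X ^ j * X ^ b) = C (X ^ b) * X ^ (j + b) := by
    simp only [map_mul, map_pow, blowUp_C_X, blowUp_X]
    ring
  rw [linearProduct, mul_assoc, map_mul, add_assoc, h1,
    coeff_mul_add_eq_of_natDegree_le h0 (natDegree_C_mul_X_pow_le _ _), e0]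
  rw [coeff_C_mul_X_pow, if_pos rfl, mul_comm]

lemma blowUp_linearRemainder (t a₁ a₂ : k) (a j b : ℕ) :
    blowUp k (linearRemainder t a₁ a₂ a j b) =
      C (C (j * a₁) * (X * (1 + X)) + C (b * a₂) * (1 + X) - C (a * (2 - a₁ - a₂)) * X) * X ^ 2 +
        C (-(C (2 * t) * (C (j * a₁) * X + C (b * a₂)))) * X + C 0 := by
  rw [linearRemainder]
  simp only [map_sub, map_add, map_mul, blowUp_C_C, blowUp_C_X, blowUp_X, map_zero, map_neg,
    map_one]
  ring

/-- Cofactors of polynomials for the Painlevé vector field have degree at most one, and their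
leading forms are determined by the leading forms of the polynomials. -/
lemma exists_cofactor (d : Derivation R k k) (t a₁ a₂ : k) (F G : k[X][X]) (hF : F ≠ 0)
    (hFG : fieldDer d t a₁ a₂ F = G * F) :
    ∃ (g₁ : k[X]) (g₀ : k), blowUp k G = C g₁ * X + C (C g₀) ∧ g₁.natDegree ≤ 1 ∧
      ((blowUp k F).natDegree : k[X]) * (1 + 2 * X) * (blowUp k F).leadingCoeff -
        3 * X * (1 + X) * derivative (blowUp k F).leadingCoeff =
          g₁ * (blowUp k F).leadingCoeff := by
  set m := (blowUp k F).natDegree with hm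
  have hne : blowUp k F ≠ 0 := by
    intro h0
    have h1 := eq_C_C_of_natDegree_blowUp_eq_zero F (by simp [h0])
    rw [h1, blowUp_C_C] at h0
    rw [C_eq_zero.1 h0] at h1
    exact hF (by simpa using h1)
  have hδ : chartDer d t a₁ a₂ (blowUp k F) = X * (blowUp k G * blowUp k F) := by
    rw [chartDer_blowUp, hFG, map_mul]
  have hdeg : (blowUp k G).natDegree ≤ 1 := by
    by_cases hG : blowUp k G = 0
    · simp [hG]
    have h1 := natDegree_chartDer_le d t a₁ a₂ (blowUp k F) le_rfl
    rw [hδ, natDegree_X_mul (mul_ne_zero hG hne), natDegree_mul hG hne] at h1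
    omega
  have hG := eq_X_add_C_of_natDegree_le_one hdeg
  have h0 := natDegree_coeff_blowUp_le G 0
  rw [eq_C_of_natDegree_le_zero h0] at hG
  refine ⟨_, _, hG, natDegree_coeff_blowUp_le G 1, ?_⟩
  rw [leadingCoeff, ← hm, ← coeff_chartDer d t a₁ a₂ _ hm.ge, hδ,
    show 2 + m = (1 + m) + 1 by ring, coeff_X_mul, coeff_mul_add_eq_of_natDegree_le hdeg hm.ge]

lemma coeff_mul_lie (d : Derivation R k k) (t a₁ a₂ : k) (H G : k[X][X]) (g₁ : k[X]) (g₀ : k)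
    (hG : blowUp k G = C g₁ * X + C (C g₀)) {n : ℕ} (hn : (blowUp k H).natDegree ≤ n) :
    (blowUp k (linearProduct t 1 1 1 * (fieldDer d t a₁ a₂ H - G * H))).coeff (4 + n) =
      X * (1 + X) * ((n : k[X]) * (1 + 2 * X) * (blowUp k H).coeff n -
        3 * X * (1 + X) * derivative ((blowUp k H).coeff n) - g₁ * (blowUp k H).coeff n) := by
  have hG1 : (C g₁ * X + C (C g₀)).natDegree ≤ 1 := natDegree_linear_le
  have h1 := coeff_chartDer d t a₁ a₂ (blowUp k H) hn
  have h2 := natDegree_chartDer_le d t a₁ a₂ (blowUp k H) hn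
  have h3 : (X * (blowUp k G * blowUp k H)).natDegree ≤ 1 + (1 + n) :=
    natDegree_mul_le_of_le natDegree_X_le (natDegree_mul_le_of_le (hG ▸ hG1) hn)
  have h4 : (X * (blowUp k G * blowUp k H)).coeff (2 + n) = g₁ * (blowUp k H).coeff n := by
    rw [show 2 + n = (1 + n) + 1 by ring, coeff_X_mul,
      coeff_mul_add_eq_of_natDegree_le (hG ▸ hG1) hn, hG]
    simp
  rw [← coeff_X_mul, map_mul, map_sub, map_mul,
    show X * (blowUp k (linearProduct t 1 1 1) *
      (blowUp k (fieldDer d t a₁ a₂ H) - blowUp k G * blowUp k H)) =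
      blowUp k (linearProduct t 1 1 1) *
      (X * blowUp k (fieldDer d t a₁ a₂ H) - X * (blowUp k G * blowUp k H)) by ring,
    ← chartDer_blowUp, show 4 + n + 1 = 3 + (2 + n) by ring,
    coeff_mul_add_eq_of_natDegree_le (natDegree_blowUp_linearProduct_le t 1 1 1)
      ((natDegree_sub_le _ _).trans (max_le h2 (h3.trans (by omega)))),
    coeff_blowUp_linearProduct t 1 1 1, coeff_sub, h1, h4]
  ring

lemma exists_relation_of_leadingCoeff [CharZero k] (d : Derivation R k k) (t a₁ a₂ : k)
    (ht : d t = 1) (F G : k[X][X]) (hFG : fieldDer d t a₁ a₂ F = G * F) (m : ℕ) (hm : 0 < m)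
    (hFm : (blowUp k F).natDegree ≤ m) (a b : ℕ)
    (hlead : (blowUp k F).coeff m = X ^ b * (1 + X) ^ a) (g₀ : k)
    (hG : blowUp k G = C ((m : k[X]) * (1 + 2 * X) - 3 * (b : k[X]) * (1 + X) -
      3 * (a : k[X]) * X) * X + C (C g₀)) :
    ∃ i j l : ℕ, (i + j + l ≠ 0) ∧ (i : k) * (2 - a₁ - a₂) + j * a₁ + l * a₂ = 0 := by
  obtain ⟨j, rfl⟩ : ∃ j, m = a + j + b := by
    have h := natDegree_coeff_blowUp_le F m
    have hX : (1 + X : k[X]).natDegree = 1 := by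
      rw [add_comm, ← C_1, natDegree_X_add_C]
    have hX0 : (1 + X : k[X]) ≠ 0 := by
      rintro h0
      simp [h0] at hX
    rw [hlead, natDegree_mul (pow_ne_zero _ X_ne_zero) (pow_ne_zero _ hX0), natDegree_pow,
      natDegree_pow, hX, natDegree_X] at h
    exact ⟨m - a - b, by omega⟩
  refine ⟨a, j, b, by omega, ?_⟩
  set m := a + j + b with hmdef
  set M := linearProduct t a j b with hM
  set T := linearProduct t 1 1 1 with hT
  set E := linearRemainder t a₁ a₂ a j b with hE
  set H := F - M with hH
  set g : k := 2 * t * (b - j) - g₀ with hg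
  -- the equation satisfied by the lower order part `H`
  have hL : blowUp k (T * (fieldDer d t a₁ a₂ H - G * H)) =
      -((blowUp k T * C (C g) + blowUp k E) * blowUp k M) := by
    have h1 := congrArg (blowUp k) (fieldDer_linearProduct d t a₁ a₂ ht a j b)
    rw [hH, map_sub, hFG]
    simp only [map_mul, map_add, map_sub, blowUp_C_C, blowUp_C_X, blowUp_X, map_natCast,
      hG] at h1 ⊢
    simp only [hg, hmdef, map_mul, map_sub, map_natCast, map_ofNat, map_one,
      Nat.cast_add] at h1 ⊢
    linear_combination -h1
  have hTdeg : (blowUp k T).natDegree ≤ 3 := natDegree_blowUp_linearProduct_le t 1 1 1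
  have hTc : (blowUp k T).coeff 3 = X * (1 + X) := by
    simpa using coeff_blowUp_linearProduct t 1 1 1
  have hEdeg : (blowUp k E).natDegree ≤ 2 := by
    rw [hE, blowUp_linearRemainder]
    exact natDegree_quadratic_le
  have hEc : (blowUp k E).coeff 2 = C (j * a₁) * (X * (1 + X)) + C (b * a₂) * (1 + X) -
      C (a * (2 - a₁ - a₂)) * X := by
    rw [hE, blowUp_linearRemainder]
    simp only [coeff_add, coeff_C_mul_X_pow, coeff_C_mul_X, coeff_C]
    norm_num
  have hMdeg : (blowUp k M).natDegree ≤ m := natDegree_blowUp_linearProduct_le t a j b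
  have hMc : (blowUp k M).coeff m = X ^ b * (1 + X) ^ a := coeff_blowUp_linearProduct t a j b
  have hXne : (X * (1 + X) : k[X]) ≠ 0 := by
    refine mul_ne_zero X_ne_zero fun h ↦ ?_
    have := congrArg (eval 0) h
    simp at this
  -- `H` has degree at most `m - 1`
  have hH1 : (blowUp k H).natDegree ≤ m - 1 := by
    refine natDegree_le_iff_coeff_eq_zero.2 fun n hn ↦ ?_
    rw [hH, map_sub, coeff_sub]
    rcases eq_or_lt_of_le (show m ≤ n by omega) with rfl | hlt
    · rw [hlead, hMc, sub_self]
    · rw [coeff_eq_zero_of_natDegree_lt (by omega), coeff_eq_zero_of_natDegree_lt (by omega),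
        sub_zero]
  -- the part of degree `m - 1` vanishes
  obtain ⟨hc0, hg0⟩ : (blowUp k H).coeff (m - 1) = 0 ∧ g = 0 := by
    have h1 := coeff_mul_lie d t a₁ a₂ H G _ g₀ hG hH1
    rw [hL, coeff_neg, show 4 + (m - 1) = 3 + m by omega,
      coeff_mul_add_eq_of_natDegree_le (natDegree_add_le_of_degree_le
        (natDegree_mul_le_of_le hTdeg (natDegree_C _).le) (hEdeg.trans (by omega))) hMdeg,
      hMc, coeff_add, coeff_mul_C, hTc, coeff_eq_zero_of_natDegree_lt (by omega)] at h1
    obtain ⟨χ, hχ, hχ'⟩ := exists_eq_mul_of_ode (-1) (by norm_num) b a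
      ((blowUp k H).coeff (m - 1)) (C (-g)) (by
        apply mul_left_cancel₀ hXne
        rw [Nat.cast_sub (by omega : 1 ≤ m)] at h1
        simp only [map_neg]
        push_cast at h1 ⊢
        linear_combination -h1)
    obtain ⟨rfl, h2⟩ := eq_zero_of_ode_const _ _ hχ'
    exact ⟨by simpa using hχ, by simpa using h2⟩
  -- the part of degree `m - 2`
  obtain ⟨η, hη⟩ : ∃ η : k[X], X * (1 + X) * (((m : k[X]) - 2) * (1 + 2 * X) * η -
      3 * X * (1 + X) * derivative η - ((m : k[X]) * (1 + 2 * X) - 3 * (b : k[X]) * (1 + X) -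
      3 * (a : k[X]) * X) * η) = -((blowUp k E).coeff 2 * (X ^ b * (1 + X) ^ a)) := by
    have h0 : (-((blowUp k T * C (C g) + blowUp k E) * blowUp k M)).coeff (2 + m) =
        -((blowUp k E).coeff 2 * (X ^ b * (1 + X) ^ a)) := by
      rw [hg0, C_0, C_0, mul_zero, zero_add, coeff_neg,
        coeff_mul_add_eq_of_natDegree_le hEdeg hMdeg, hMc]
    rw [← hL] at h0
    rcases Nat.lt_or_ge 1 m with h1m | h1m
    · have hH2 : (blowUp k H).natDegree ≤ m - 2 := by
        refine natDegree_le_iff_coeff_eq_zero.2 fun n hn ↦ ?_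
        rcases eq_or_lt_of_le (show m - 1 ≤ n by omega) with rfl | hlt
        · exact hc0
        · exact coeff_eq_zero_of_natDegree_lt (by omega)
      have h1 := coeff_mul_lie d t a₁ a₂ H G _ g₀ hG hH2
      rw [show 4 + (m - 2) = 2 + m by omega, h0, Nat.cast_sub (by omega : 2 ≤ m)] at h1
      exact ⟨_, by exact_mod_cast h1.symm⟩
    · have h1 := coeff_mul_lie d t a₁ a₂ H G _ g₀ hG hH1
      have hH0 : blowUp k H = 0 := by
        rw [eq_C_of_natDegree_le_zero (hH1.trans (by omega)), ← C_0, ← hc0]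
        congr 2
        omega
      refine ⟨0, ?_⟩
      rw [← h0, map_mul, map_sub, map_mul, hH0, ← coeff_X_mul,
        show X * (blowUp k T * (blowUp k (fieldDer d t a₁ a₂ H) - blowUp k G * 0)) =
          blowUp k T * (X * blowUp k (fieldDer d t a₁ a₂ H)) by ring, ← chartDer_blowUp, hH0]
      simp
  rw [hEc] at hη
  obtain ⟨χ, hχ, hχ'⟩ := exists_eq_mul_of_ode 1 (by norm_num) b a (X * (1 + X) * η)
    (C (a * (2 - a₁ - a₂)) * X - C (j * a₁) * (X * (1 + X)) - C (b * a₂) * (1 + X)) (by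
      simp only [derivative_mul, derivative_add, derivative_one, derivative_X]
      push_cast
      linear_combination hη)
  exact add_eq_zero_of_ode_quadratic _ _ _ χ hχ'

/-- A nonconstant polynomial dividing its derivative along the fourth Painlevé vector field forces
a linear relation with nonnegative integer coefficients between the parameters. -/
theorem exists_relation_of_dvd [CharZero k] (d : Derivation R k k) (t a₁ a₂ : k)
    (ht : d t = 1) (F : k[X][X]) (hF : ∀ c, F ≠ C (C c)) (hdvd : F ∣ fieldDer d t a₁ a₂ F) :
    ∃ i j l : ℕ, (i + j + l ≠ 0) ∧ (i : k) * (2 - a₁ - a₂) + j * a₁ + l * a₂ = 0 := by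
  have hF0 : F ≠ 0 := by simpa using hF 0
  have hm : 0 < (blowUp k F).natDegree := by
    by_contra! h
    exact hF _ (eq_C_C_of_natDegree_blowUp_eq_zero F (by omega))
  obtain ⟨G, hG⟩ := hdvd
  rw [mul_comm] at hG
  obtain ⟨g₁, g₀, hG1, hdeg, hode⟩ := exists_cofactor d t a₁ a₂ F G hF0 hG
  obtain ⟨b, a, c, hc, hlead, rfl⟩ := exists_eq_C_mul_of_darboux _ _ _
    (leadingCoeff_ne_zero.2 (by
      rintro h
      simp [h] at hm)) hdeg hode
  have hcc : C (C c⁻¹) * C (C c) = (1 : k[X][X]) := by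
    rw [← C_mul, ← C_mul, inv_mul_cancel₀ hc, C_1, C_1]
  refine exists_relation_of_leadingCoeff d t a₁ a₂ ht (C (C c⁻¹) * F)
    (G + C (C (d c⁻¹ * c))) ?_ _ hm ?_ a b ?_ (g₀ + d c⁻¹ * c) ?_
  · have h1 : fieldDer d t a₁ a₂ (C (C c⁻¹)) = C (C (d c⁻¹)) := by simp [fieldDer]
    rw [Derivation.leibniz, hG, h1, smul_eq_mul, smul_eq_mul, C_mul, C_mul]
    linear_combination -(C (C (d c⁻¹)) * F) * hcc
  · rw [map_mul, blowUp_C_C]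
    exact natDegree_C_mul_le _ _
  · rw [map_mul, blowUp_C_C, coeff_C_mul, coeff_natDegree, hlead, ← mul_assoc, ← C_mul,
      inv_mul_cancel₀ hc, C_1, one_mul]
  · rw [map_add, hG1, blowUp_C_C, C_add, C_add]
    ring

end InvariantCurves

end PainleveIV

namespace PainleveIV

open Polynomial

section Elimination

variable {k L : Type*} [Field k] [Field L] [Algebra k L]

/-- Evaluation of bivariate polynomials intertwines the fourth Painlevé vector field with the
derivation, at any solution. -/
lemma aevalAeval_fieldDer (d : Derivation ℤ k k) (D : Derivation ℤ L L)
    (hd : ∀ a, algebraMap k L (d a) = D (algebraMap k L a)) (t a₁ a₂ : k) (f₁ f₂ : L)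
    (h₁ : D f₁ = f₁ * (2 * f₂ + f₁ - 2 * algebraMap k L t) + algebraMap k L a₁)
    (h₂ : D f₂ = f₂ * (2 * algebraMap k L t - 2 * f₁ - f₂) + algebraMap k L a₂)
    (F : k[X][X]) : aevalAeval f₁ f₂ (fieldDer d t a₁ a₂ F) = D (aevalAeval f₁ f₂ F) := by
  induction F using bivariate_induction with
  | hC a => simp [fieldDer, hd]
  | hY =>
    simp [fieldDer, h₁, map_ofNat (algebraMap k L) 2]
  | hX =>
    simp [fieldDer, h₂, map_ofNat (algebraMap k L) 2]
  | hadd F G hF hG =>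
    simp only [map_add, hF, hG]
  | hmul F G hF hG =>
    simp only [map_mul, Derivation.leibniz, hF, hG, smul_eq_mul, map_add]

/-- A primitive irreducible polynomial divides every polynomial vanishing at the same generic
point. -/
lemma dvd_of_aevalAeval_eq_zero (f₁ f₂ : L) (hf₁ : Transcendental k f₁) (F G : k[X][X])
    (hF : Irreducible F) (hFdeg : F.natDegree ≠ 0) (hF0 : aevalAeval f₁ f₂ F = 0)
    (hG0 : aevalAeval f₁ f₂ G = 0) : F ∣ G := by
  have hprim : F.IsPrimitive := hF.isPrimitive hFdeg
  have hinj : Function.Injective (aeval f₁ : k[X] →ₐ[k] L).toRingHom :=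
    transcendental_iff_injective.1 hf₁
  refine hprim.dvd_of_fraction_map_dvd_fraction_map (K := FractionRing k[X]) ?_
  have hirr := (hprim.irreducible_iff_irreducible_map_fraction_map (K := FractionRing k[X])).1 hF
  by_contra hndvd
  obtain ⟨u, v, huv⟩ := (hirr.coprime_iff_not_dvd).2 hndvd
  have hev (P : k[X][X]) : eval₂ (IsFractionRing.lift hinj) f₂
      (P.map (algebraMap k[X] (FractionRing k[X]))) = aevalAeval f₁ f₂ P := by
    have hcomp : (IsFractionRing.lift hinj).comp (algebraMap k[X] (FractionRing k[X])) =
        (aeval f₁ : k[X] →ₐ[k] L).toRingHom :=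
      RingHom.ext fun p ↦ IsFractionRing.lift_algebraMap hinj p
    rw [eval₂_map, hcomp]
    induction P using bivariate_induction with
    | hC a => simp
    | hY => simp
    | hX => simp
    | hadd F G hF hG => simp only [eval₂_add, map_add, hF, hG]
    | hmul F G hF hG => simp only [eval₂_mul, map_mul, hF, hG]
  have h := congrArg (eval₂ (IsFractionRing.lift hinj) f₂) huv
  rw [eval₂_add, eval₂_mul, eval₂_mul, hev, hev, hF0, hG0] at h
  simp at h

lemma exists_aevalAeval_eq_zero {f₁ f₂ : L} (h : ¬ AlgebraicIndependent k ![f₁, f₂]) :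
    ∃ P : k[X][X], aevalAeval f₁ f₂ P = 0 ∧ P ≠ 0 := by
  rw [algebraicIndependent_iff] at h
  push Not at h
  obtain ⟨p, hp, hp0⟩ := h
  have hcomp (P : k[X][X]) : MvPolynomial.aeval ![f₁, f₂] (Bivariate.equivMvPolynomial k P) =
      aevalAeval f₁ f₂ P := by
    induction P using bivariate_induction with
    | hC a => simp
    | hY => simp
    | hX => simp
    | hadd F G hF hG => simp only [map_add, hF, hG]
    | hmul F G hF hG => simp only [map_mul, hF, hG]
  refine ⟨(Bivariate.equivMvPolynomial k).symm p, ?_, by simpa using hp0⟩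
  rw [← hcomp, AlgEquiv.apply_symm_apply, hp]

theorem exists_relation_of_algebraic_dependence [CharZero k] (d : Derivation ℤ k k)
    (D : Derivation ℤ L L)
    (hd : ∀ a, algebraMap k L (d a) = D (algebraMap k L a)) (t a₁ a₂ : k) (ht : d t = 1)
    (f₁ f₂ : L)
    (h₁ : D f₁ = f₁ * (2 * f₂ + f₁ - 2 * algebraMap k L t) + algebraMap k L a₁)
    (h₂ : D f₂ = f₂ * (2 * algebraMap k L t - 2 * f₁ - f₂) + algebraMap k L a₂)
    (hf₁ : Transcendental k f₁) (hdep : ¬ AlgebraicIndependent k ![f₁, f₂]) :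
    ∃ i j l : ℕ, (i + j + l ≠ 0) ∧ (i : k) * (2 - a₁ - a₂) + j * a₁ + l * a₂ = 0 := by
  obtain ⟨P, hP0, hP⟩ := exists_aevalAeval_eq_zero hdep
  set I := RingHom.ker (aevalAeval f₁ f₂ : k[X][X] →ₐ[k] L) with hI
  have hIne : I ≠ ⊥ := fun h ↦ hP (by rwa [← Ideal.mem_bot, ← h])
  obtain ⟨F, hFI, hF⟩ := (RingHom.ker_isPrime _ : I.IsPrime).exists_mem_prime_of_ne_bot hIne
  replace hFI : aevalAeval f₁ f₂ F = 0 := hFI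
  have hFdeg : F.natDegree ≠ 0 := by
    intro h
    rw [eq_C_of_natDegree_eq_zero h] at hFI
    have h0 : F.coeff 0 = 0 := (transcendental_iff.1 hf₁) _ (by simpa using hFI)
    exact hF.ne_zero (by rw [eq_C_of_natDegree_eq_zero h, h0, C_0])
  refine exists_relation_of_dvd d t a₁ a₂ ht F (fun c h ↦ hFdeg (by simp [h])) ?_
  refine dvd_of_aevalAeval_eq_zero f₁ f₂ hf₁ F _ hF.irreducible hFdeg hFI ?_
  rw [aevalAeval_fieldDer d D hd t a₁ a₂ f₁ f₂ h₁ h₂, hFI, map_zero]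

end Elimination

end PainleveIV

namespace PainleveIV

section Symmetries

variable {L : Type*} [Field L] [Algebra ℂ L]

lemma algebraMap_two_mul (c : ℂ) : algebraMap ℂ L (2 * c) = 2 * algebraMap ℂ L c := by
  rw [map_mul, map_ofNat]

/-- The symmetric form of the fourth Painlevé equation, with parameters of sum `1`. -/
structure IsSolution (D : Derivation ℂ L L) (t : L) (α₀ α₁ α₂ : ℂ) (f₀ f₁ f₂ : L) : Prop where
  param_sum : α₀ + α₁ + α₂ = 1
  sum : f₀ + f₁ + f₂ = 2 * t
  deriv₀ : D f₀ = f₀ * (f₁ - f₂) + 2 * algebraMap ℂ L α₀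
  deriv₁ : D f₁ = f₁ * (f₂ - f₀) + 2 * algebraMap ℂ L α₁
  deriv₂ : D f₂ = f₂ * (f₀ - f₁) + 2 * algebraMap ℂ L α₂

lemma IsSolution.rotate {D : Derivation ℂ L L} {t : L} {α₀ α₁ α₂ : ℂ} {f₀ f₁ f₂ : L}
    (h : IsSolution D t α₀ α₁ α₂ f₀ f₁ f₂) : IsSolution D t α₁ α₂ α₀ f₁ f₂ f₀ where
  param_sum := by linear_combination h.param_sum
  sum := by linear_combination h.sum
  deriv₀ := h.deriv₁
  deriv₁ := h.deriv₂
  deriv₂ := h.deriv₀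

/-- The Bäcklund transformation attached to the middle root. -/
lemma IsSolution.reflect {D : Derivation ℂ L L} {t : L} {α₀ α₁ α₂ : ℂ} {f₀ f₁ f₂ : L}
    (h : IsSolution D t α₀ α₁ α₂ f₀ f₁ f₂) (hf₁ : f₁ ≠ 0) :
    IsSolution D t (α₀ + α₁) (-α₁) (α₂ + α₁) (f₀ - 2 * algebraMap ℂ L α₁ / f₁) f₁
      (f₂ + 2 * algebraMap ℂ L α₁ / f₁) := by
  have hq : D (2 * algebraMap ℂ L α₁ / f₁) =
      -(2 * algebraMap ℂ L α₁) * (f₁ * (f₂ - f₀) + 2 * algebraMap ℂ L α₁) / f₁ ^ 2 := by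
    rw [div_eq_mul_inv, Derivation.leibniz, Derivation.leibniz_inv, h.deriv₁,
      ← algebraMap_two_mul, D.map_algebraMap]
    simp only [smul_eq_mul, mul_zero, add_zero]
    field_simp
  constructor
  · linear_combination h.param_sum
  · linear_combination h.sum
  · rw [map_sub, hq, h.deriv₀, map_add]
    field_simp
    ring
  · rw [h.deriv₁, map_neg]
    field_simp
    ring
  · rw [map_add, hq, h.deriv₂, map_add]
    field_simp
    ring

/-- The symmetric form has a solution in `N` whose components do not all lie in `M`. -/
def HasSolution (D : Derivation ℂ L L) (t : L) (M N : Subfield L) (α₀ α₁ α₂ : ℂ) : Prop :=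
  ∃ f₀ f₁ f₂ : L, IsSolution D t α₀ α₁ α₂ f₀ f₁ f₂ ∧ (f₀ ∈ N ∧ f₁ ∈ N ∧ f₂ ∈ N) ∧
    ¬ (f₀ ∈ M ∧ f₁ ∈ M ∧ f₂ ∈ M)

namespace HasSolution

variable {D : Derivation ℂ L L} {t : L} {M N : Subfield L} {α₀ α₁ α₂ : ℂ}

lemma rotate (h : HasSolution D t M N α₀ α₁ α₂) : HasSolution D t M N α₁ α₂ α₀ := by
  obtain ⟨f₀, f₁, f₂, h, hN, hM⟩ := h
  exact ⟨f₁, f₂, f₀, h.rotate, by tauto, by tauto⟩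

lemma param_sum (h : HasSolution D t M N α₀ α₁ α₂) : α₀ + α₁ + α₂ = 1 := by
  obtain ⟨f₀, f₁, f₂, h, -, -⟩ := h
  exact h.param_sum

lemma reflect (hM : ∀ c, algebraMap ℂ L c ∈ M) (hMN : M ≤ N)
    (h : HasSolution D t M N α₀ α₁ α₂) :
    HasSolution D t M N (α₀ + α₁) (-α₁) (α₂ + α₁) := by
  by_cases hα : α₁ = 0
  · simpa [hα] using h
  obtain ⟨f₀, f₁, f₂, h, ⟨h0, h1, h2⟩, hne⟩ := h
  have hf₁ : f₁ ≠ 0 := by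
    rintro rfl
    have h' := h.deriv₁
    rw [map_zero, zero_mul, zero_add, ← algebraMap_two_mul] at h'
    simp [hα] at h'
  have ha : 2 * algebraMap ℂ L α₁ ∈ M := by
    simpa only [algebraMap_two_mul] using hM (2 * α₁)
  refine ⟨_, _, _, h.reflect hf₁, ⟨N.sub_mem h0 (N.div_mem (hMN ha) h1), h1,
    N.add_mem h2 (N.div_mem (hMN ha) h1)⟩, fun ⟨g0, g1, g2⟩ ↦ hne ⟨?_, g1, ?_⟩⟩
  · simpa using M.add_mem g0 (M.div_mem ha g1)
  · simpa using M.sub_mem g2 (M.div_mem ha g1)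

lemma shift (hM : ∀ c, algebraMap ℂ L c ∈ M) (hMN : M ≤ N)
    (h : HasSolution D t M N α₀ α₁ α₂) : HasSolution D t M N (α₀ - 1) (α₁ + 1) α₂ := by
  have h1 := ((h.reflect hM hMN).rotate.reflect hM hMN).rotate
  have hs := h.param_sum
  convert h1 using 1
  · linear_combination hs
  · linear_combination -hs
  · ring

lemma shift_int (hM : ∀ c, algebraMap ℂ L c ∈ M) (hMN : M ≤ N)
    (h : HasSolution D t M N α₀ α₁ α₂) (n : ℤ) :
    HasSolution D t M N (α₀ - n) (α₁ + n) α₂ := by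
  induction n with
  | zero => simpa using h
  | succ n ih =>
    have := ih.shift hM hMN
    push_cast at this ⊢
    convert this using 1 <;> ring
  | pred n ih =>
    have := ((ih.rotate.shift hM hMN).rotate.shift hM hMN).rotate
    push_cast at this ⊢
    convert this using 1 <;> ring

end HasSolution

end Symmetries

section Chamber

/-- The real linear form `re + θ im` on `ℂ`. -/
noncomputable def slopeForm (θ : ℝ) : ℂ →+ ℝ :=
  Complex.reAddGroupHom + (AddMonoidHom.mulLeft θ).comp Complex.imAddGroupHom

lemma slopeForm_apply (θ : ℝ) (w : ℂ) : slopeForm θ w = w.re + θ * w.im := rfl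

@[simp]
lemma slopeForm_intCast (θ : ℝ) (n : ℤ) : slopeForm θ n = n := by
  simp [slopeForm_apply]

@[simp]
lemma slopeForm_natCast_mul (θ : ℝ) (n : ℕ) (w : ℂ) : slopeForm θ (n * w) = n * slopeForm θ w := by
  rw [← nsmul_eq_mul, map_nsmul, nsmul_eq_mul]

lemma countable_slopeForm_mem_range (w : ℂ) (hw : ∀ n : ℤ, w ≠ n) :
    {θ | ∃ n : ℤ, slopeForm θ w = n}.Countable := by
  refine (Set.countable_range fun n : ℤ ↦ ((n : ℝ) - w.re) / w.im).mono ?_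
  rintro θ ⟨n, hn⟩
  rw [slopeForm_apply] at hn
  refine ⟨n, ?_⟩
  have him : w.im ≠ 0 := by
    intro h
    refine hw n (Complex.ext ?_ ?_)
    · simpa [h] using hn
    · simpa using h
  simp only [← hn]
  field_simp
  ring

lemma exists_slopeForm_ne_intCast (u v w : ℂ) (hu : ∀ n : ℤ, u ≠ n) (hv : ∀ n : ℤ, v ≠ n)
    (hw : ∀ n : ℤ, w ≠ n) :
    ∃ θ, (∀ n : ℤ, slopeForm θ u ≠ n) ∧ (∀ n : ℤ, slopeForm θ v ≠ n) ∧
      ∀ n : ℤ, slopeForm θ w ≠ n := by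
  by_contra! h
  refine Cardinal.not_countable_real ((((countable_slopeForm_mem_range u hu).union
    (countable_slopeForm_mem_range v hv)).union (countable_slopeForm_mem_range w hw)).mono ?_)
  intro θ _
  simp only [Set.mem_union, Set.mem_ofPred_eq]
  by_cases h1 : ∃ n : ℤ, slopeForm θ u = n
  · exact Or.inl (Or.inl h1)
  by_cases h2 : ∃ n : ℤ, slopeForm θ v = n
  · exact Or.inl (Or.inr h2)
  push Not at h1 h2
  exact Or.inr (h θ h1 h2)

variable {L : Type*} [Field L] [Algebra ℂ L] {D : Derivation ℂ L L} {t : L} {M N : Subfield L}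

/-- Parameters off the integral walls can be moved to the fundamental chamber. -/
lemma HasSolution.exists_pos {α₀ α₁ α₂ : ℂ} (hM : ∀ c, algebraMap ℂ L c ∈ M) (hMN : M ≤ N)
    (h : HasSolution D t M N α₀ α₁ α₂) (h0 : ∀ n : ℤ, α₀ ≠ n) (h1 : ∀ n : ℤ, α₁ ≠ n)
    (h2 : ∀ n : ℤ, α₂ ≠ n) :
    ∃ θ β₀ β₁ β₂, HasSolution D t M N β₀ β₁ β₂ ∧ 0 < slopeForm θ β₀ ∧ 0 < slopeForm θ β₁ ∧
      0 < slopeForm θ β₂ := by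
  obtain ⟨θ, e0, e1, e2⟩ := exists_slopeForm_ne_intCast α₀ α₁ α₂ h0 h1 h2
  set m := ⌊slopeForm θ α₁⌋ with hm
  set n := ⌊slopeForm θ α₂⌋ with hn
  have hs := congrArg (slopeForm θ) h.param_sum
  have hone : slopeForm θ 1 = 1 := by simpa using slopeForm_intCast θ 1
  simp only [map_add, hone] at hs
  have m1 := (Int.floor_le (slopeForm θ α₁)).lt_of_ne (e1 m).symm
  have m2 := Int.lt_floor_add_one (slopeForm θ α₁)
  have n1 := (Int.floor_le (slopeForm θ α₂)).lt_of_ne (e2 n).symm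
  have n2 := Int.lt_floor_add_one (slopeForm θ α₂)
  rw [← hm] at m1 m2
  rw [← hn] at n1 n2
  have h' := ((h.shift_int hM hMN (-m)).rotate.rotate.shift_int hM hMN n).rotate
  have z0 : slopeForm θ α₀ + m + n ≠ 0 := by
    intro hz
    apply e0 (-m - n)
    push_cast
    linarith
  rcases lt_or_gt_of_ne z0 with hlt | hgt
  · refine ⟨θ, _, _, _, h'.rotate.rotate.reflect hM hMN, ?_, ?_, ?_⟩ <;>
    · simp only [map_add, map_sub, map_neg, slopeForm_intCast, Int.cast_neg]
      linarith
  · refine ⟨θ, _, _, _, h', ?_, ?_, ?_⟩ <;>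
    · simp only [map_add, map_sub, map_neg, slopeForm_intCast, Int.cast_neg]
      linarith

/-- Solutions with parameters in the fundamental chamber satisfy no algebraic relation. -/
lemma IsSolution.algebraicIndependent {K : Subfield L} (hK : ∀ c, algebraMap ℂ L c ∈ K)
    (htK : t ∈ K) (hDK : ∀ a ∈ K, D a ∈ K) (hDt : D t = 1) {θ : ℝ} {β₀ β₁ β₂ : ℂ} {f₀ f₁ f₂ : L}
    (h : IsSolution D t β₀ β₁ β₂ f₀ f₁ f₂) (h0 : 0 < slopeForm θ β₀) (h1 : 0 < slopeForm θ β₁)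
    (h2 : 0 < slopeForm θ β₂) (hf₁ : Transcendental K f₁) :
    AlgebraicIndependent K ![f₁, f₂] := by
  by_contra hdep
  have : CharZero L := charZero_of_injective_algebraMap (algebraMap ℂ L).injective
  let d : Derivation ℤ K K := Derivation.mk'
    { toFun := fun a ↦ ⟨D a, hDK a a.2⟩
      map_add' := fun a b ↦ by ext; simp
      map_smul' := fun n a ↦ by ext; simp } fun a b ↦ by ext; simp
  have hd (a : K) : algebraMap K L (d a) = D.restrictScalars ℤ (algebraMap K L a) := rfl
  obtain ⟨i, j, l, hne, hrel⟩ := exists_relation_of_algebraic_dependence d (D.restrictScalars ℤ) hd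
    ⟨t, htK⟩ ⟨algebraMap ℂ L (2 * β₁), hK _⟩ ⟨algebraMap ℂ L (2 * β₂), hK _⟩
    (Subtype.ext hDt) f₁ f₂
    (by
      change D f₁ = f₁ * (2 * f₂ + f₁ - 2 * t) + algebraMap ℂ L (2 * β₁)
      rw [h.deriv₁, algebraMap_two_mul]
      linear_combination (-f₁) * h.sum)
    (by
      change D f₂ = f₂ * (2 * t - 2 * f₁ - f₂) + algebraMap ℂ L (2 * β₂)
      rw [h.deriv₂, algebraMap_two_mul]
      linear_combination f₂ * h.sum) hf₁ hdep
  have hrel' : i * β₀ + j * β₁ + l * β₂ = 0 := by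
    have h3 := congrArg (algebraMap K L) hrel
    simp only [map_add, map_sub, map_mul, map_natCast, map_zero, map_ofNat] at h3
    replace h3 : i * (2 - 2 * algebraMap ℂ L β₁ - 2 * algebraMap ℂ L β₂) +
      j * (2 * algebraMap ℂ L β₁) + l * (2 * algebraMap ℂ L β₂) = 0 := h3
    have h4 := congrArg (algebraMap ℂ L) h.param_sum
    simp only [map_add, map_one] at h4
    apply (algebraMap ℂ L).injective
    simp only [map_add, map_mul, map_natCast, map_zero]
    linear_combination h3 / 2 + i * h4
  have h3 := congrArg (slopeForm θ) hrel'
  simp only [map_add, slopeForm_natCast_mul, map_zero] at h3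
  have p0 := mul_nonneg (Nat.cast_nonneg i : (0 : ℝ) ≤ i) h0.le
  have p1 := mul_nonneg (Nat.cast_nonneg j : (0 : ℝ) ≤ j) h1.le
  have p2 := mul_nonneg (Nat.cast_nonneg l : (0 : ℝ) ≤ l) h2.le
  have q0 : (i : ℝ) * slopeForm θ β₀ = 0 := by linarith
  have q1 : (j : ℝ) * slopeForm θ β₁ = 0 := by linarith
  have q2 : (l : ℝ) * slopeForm θ β₂ = 0 := by linarith
  simp only [mul_eq_zero, Nat.cast_eq_zero, h0.ne', h1.ne', h2.ne', or_false] at q0 q1 q2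
  omega

end Chamber

end PainleveIV

namespace PainleveIV

open IntermediateField

section Independence

variable {k L : Type*} [Field k] [Field L] [Algebra k L]

lemma algebraicIndependent_pair_iff (x y : L) :
    AlgebraicIndependent k ![x, y] ↔ Transcendental k x ∧ Transcendental k⟮x⟯ y := by
  have : Unique {j : Fin 2 // j ≠ 1} := ⟨⟨⟨0, by simp⟩⟩, by
    rintro ⟨j, hj⟩
    ext
    have := Fin.val_ne_of_ne hj
    simp only [Fin.isValue, Fin.val_one] at this ⊢
    change (j : ℕ) = 0
    omega⟩
  have himg : ![x, y] '' {1}ᶜ = {x} := by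
    ext w
    simp [eq_comm]
  rw [AlgebraicIndependent.iff_transcendental_adjoin_image 1, algebraicIndependent_unique_type_iff,
    himg, transcendental_adjoin_iff]
  have h0 : ((default : {j : Fin 2 // j ≠ 1}) : Fin 2) = 0 := by
    rw [Subsingleton.elim default (⟨0, by simp⟩ : {j : Fin 2 // j ≠ 1})]
  rw [h0]
  rfl

lemma algebraicIndependent_pair_swap {x y : L} (h : AlgebraicIndependent k ![x, y]) :
    AlgebraicIndependent k ![y, x] := by
  have := h.comp ![1, 0] (by decide)
  convert this using 1
  ext i
  fin_cases i <;> rfl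

lemma isAlgebraic_adjoin_of_not_algebraicIndependent {z x : L} (hz : Transcendental k z)
    (h : ¬ AlgebraicIndependent k ![z, x]) : IsAlgebraic k⟮z⟯ x := by
  by_contra hx
  exact h ((algebraicIndependent_pair_iff z x).2 ⟨hz, hx⟩)

lemma not_algebraicIndependent_of_isAlgebraic_adjoin {z x y : L} (hx : IsAlgebraic k⟮z⟯ x)
    (hy : IsAlgebraic k⟮z⟯ y) : ¬ AlgebraicIndependent k ![x, y] := by
  intro h
  obtain ⟨h1, h2⟩ := (algebraicIndependent_pair_iff x y).1 h
  have hz : IsAlgebraic k⟮x⟯ z := by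
    by_contra hz
    exact ((algebraicIndependent_pair_iff z x).1 (algebraicIndependent_pair_swap
      ((algebraicIndependent_pair_iff x z).2 ⟨h1, hz⟩))).2 hx
  apply h2
  have hle : k⟮z⟯ ≤ (algebraicClosure k⟮x⟯ L).restrictScalars k := by
    rw [adjoin_simple_le_iff]
    exact mem_algebraicClosure_iff.2 hz
  let A : IntermediateField k⟮x⟯ L := algebraicClosure k⟮x⟯ L
  let _ : Algebra k⟮z⟯ A := (inclusion hle).toRingHom.toAlgebra
  have : IsScalarTower k⟮z⟯ A L := IsScalarTower.of_algebraMap_eq fun _ ↦ rfl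
  have hyA : IsAlgebraic A y := hy.tower_top A
  exact hyA.restrictScalars k⟮x⟯

lemma algebraicClosure_le_algebraicClosure_adjoin (z : L) :
    (algebraicClosure k L).toSubfield ≤ (algebraicClosure k⟮z⟯ L).toSubfield := fun _ hx ↦
  mem_algebraicClosure_iff.2 ((mem_algebraicClosure_iff.1 hx).tower_top k⟮z⟯)

end Independence

section Dichotomy

variable {L : Type*} [Field L] [Algebra ℂ L] {D : Derivation ℂ L L} {t : L} {K : Subfield L}

lemma algebraMap_mem_algebraicClosure (hK : ∀ c, algebraMap ℂ L c ∈ K) (c : ℂ) :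
    algebraMap ℂ L c ∈ (algebraicClosure K L).toSubfield :=
  (algebraicClosure K L).algebraMap_mem ⟨_, hK c⟩

/-- Solutions of transcendence degree one exist only for integral parameters. -/
lemma HasSolution.exists_int (hK : ∀ c, algebraMap ℂ L c ∈ K)
    (htK : t ∈ K) (hDK : ∀ a ∈ K, D a ∈ K) (hDt : D t = 1) {z : L} {α₀ α₁ α₂ : ℂ}
    (h : HasSolution D t (algebraicClosure K L).toSubfield (algebraicClosure K⟮z⟯ L).toSubfield
      α₀ α₁ α₂) :
    (∃ n : ℤ, α₀ = n) ∨ (∃ n : ℤ, α₁ = n) ∨ ∃ n : ℤ, α₂ = n := by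
  by_contra! hint
  obtain ⟨θ, β₀, β₁, β₂, ⟨f₀, f₁, f₂, hf, ⟨g0, g1, g2⟩, hne⟩, h0, h1, h2⟩ :=
    h.exists_pos (algebraMap_mem_algebraicClosure hK)
      (algebraicClosure_le_algebraicClosure_adjoin z)
      hint.1 hint.2.1 hint.2.2
  have key {γ₀ γ₁ γ₂ : ℂ} {e₀ e₁ e₂ : L} (he : IsSolution D t γ₀ γ₁ γ₂ e₀ e₁ e₂)
      (p0 : 0 < slopeForm θ γ₀) (p1 : 0 < slopeForm θ γ₁) (p2 : 0 < slopeForm θ γ₂)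
      (q1 : IsAlgebraic K⟮z⟯ e₁) (q2 : IsAlgebraic K⟮z⟯ e₂) : IsAlgebraic K e₁ := by
    by_contra ht
    exact not_algebraicIndependent_of_isAlgebraic_adjoin q1 q2
      (he.algebraicIndependent hK htK hDK hDt p0 p1 p2 ht)
  replace g0 := mem_algebraicClosure_iff.1 g0
  replace g1 := mem_algebraicClosure_iff.1 g1
  replace g2 := mem_algebraicClosure_iff.1 g2
  exact hne ⟨mem_algebraicClosure_iff.2 (key hf.rotate.rotate h2 h0 h1 g0 g1),
    mem_algebraicClosure_iff.2 (key hf h0 h1 h2 g1 g2),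
    mem_algebraicClosure_iff.2 (key hf.rotate h1 h2 h0 g2 g0)⟩

/-- The change of variables between the Hamiltonian system and the symmetric form. -/
lemma isSolution_iff (hDt : D t = 1) (v₁ v₂ v₃ : ℂ) (y x : L) :
    IsSolution D t (1 + v₃ - v₂) (v₂ - v₁) (v₁ - v₃) (2 * t + y - x) (-y) x ↔
      D y = 2 * x * y - y ^ 2 - 2 * t * y + 2 * algebraMap ℂ L (v₁ - v₂) ∧
        D x = 2 * x * y - x ^ 2 + 2 * t * x + 2 * algebraMap ℂ L (v₁ - v₃) := by
  constructor
  · intro h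
    have h1 := h.deriv₁
    have h2 := h.deriv₂
    rw [map_neg] at h1
    simp only [map_sub] at h1 h2 ⊢
    constructor
    · linear_combination -h1
    · linear_combination h2
  · rintro ⟨h1, h2⟩
    have ht : D (2 * t) = 2 := by
      rw [two_mul, map_add, hDt, one_add_one_eq_two]
    constructor
    · ring
    · ring
    · rw [map_sub, map_add, ht, h1, h2]
      simp only [map_add, map_sub, map_one]
      ring
    · rw [map_neg, h1]
      simp only [map_sub]
      ring
    · rw [h2]
      ring

end Dichotomy

end PainleveIV

namespace PainleveIV

open IntermediateField

section FractionField

variable {R A L : Type*} [CommRing R] [CommRing A] [Algebra R A] [Field L] [Algebra R L]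
  [Algebra A L] [IsScalarTower R A L] [IsFractionRing A L]

/-- Derivations extend to the field of fractions. -/
lemma exists_derivation_fractionField (d : Derivation R A A) :
    ∃ D : Derivation R L L, ∀ a, D (algebraMap A L a) = algebraMap A L (d a) := by
  let φ : A →+* TrivSqZeroExt L L :=
    { toFun := fun a ↦ (algebraMap A L a, algebraMap A L (d a))
      map_one' := by ext <;> simp
      map_mul' := fun a b ↦ by
        ext
        · exact map_mul _ a b
        · change algebraMap A L (d (a * b)) = algebraMap A L a • algebraMap A L (d b) +
            MulOpposite.op (algebraMap A L b) • algebraMap A L (d a)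
          simp only [d.leibniz, map_add, smul_eq_mul, map_mul, op_smul_eq_smul]
      map_zero' := by ext <;> simp
      map_add' := fun a b ↦ by
        ext
        · exact map_add _ a b
        · change algebraMap A L (d (a + b)) = algebraMap A L (d a) + algebraMap A L (d b)
          rw [map_add, map_add] }
  have hφ (a : nonZeroDivisors A) : IsUnit (φ a) := by
    rw [TrivSqZeroExt.isUnit_iff_isUnit_fst]
    exact IsLocalization.map_units L a
  let ψ : L →+* TrivSqZeroExt L L := IsLocalization.lift hφ
  have hψ (a : A) : ψ (algebraMap A L a) = φ a := IsLocalization.lift_eq hφ a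
  have hfst (x : L) : (ψ x).fst = x := by
    have : (TrivSqZeroExt.fstHom L L L).toRingHom.comp ψ = RingHom.id L := by
      refine IsLocalization.ringHom_ext (nonZeroDivisors A) (RingHom.ext fun a ↦ ?_)
      exact congrArg TrivSqZeroExt.fst (hψ a)
    exact congrArg (fun f ↦ f x) this
  have hsnd (a : A) : (ψ (algebraMap A L a)).snd = algebraMap A L (d a) :=
    congrArg TrivSqZeroExt.snd (hψ a)
  refine ⟨Derivation.mk'
    { toFun := fun x ↦ (ψ x).snd
      map_add' := fun x y ↦ by rw [map_add, TrivSqZeroExt.snd_add]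
      map_smul' := fun r x ↦ ?_ } fun x y ↦ ?_, hsnd⟩
  · have h0 : (ψ (algebraMap R L r)).snd = 0 := by
      rw [IsScalarTower.algebraMap_apply R A L, hsnd, d.map_algebraMap, map_zero]
    rw [Algebra.smul_def, map_mul, TrivSqZeroExt.snd_mul, hfst, hfst, h0, smul_zero, add_zero,
      RingHom.id_apply, algebraMap_smul]
  · change (ψ (x * y)).snd = x • (ψ y).snd + y • (ψ x).snd
    rw [map_mul, TrivSqZeroExt.snd_mul, hfst, hfst, op_smul_eq_smul]

end FractionField

section RiccatiSolutions

universe u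

/-- There is a differential field extension of `ℂ(t)` containing a generic solution of a Riccati
equation. -/
lemma exists_riccati_solution (a : ℂ) :
    ∃ (L : Type u) (_ : Field L) (_ : Algebra ℂ L) (D : Derivation ℂ L L) (t z : L)
      (K : Subfield L), D t = 1 ∧ (∀ c, algebraMap ℂ L c ∈ K) ∧ t ∈ K ∧ (∀ x ∈ K, D x ∈ K) ∧
        Transcendental K z ∧ D z = -z ^ 2 + 2 * t * z + 2 * algebraMap ℂ L a := by
  let σ := ULift.{u} (Fin 2)
  let A := MvPolynomial σ ℂ
  let L := FractionRing A
  let s : σ → A := fun i ↦ if i.down = 0 then 1 else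
    -MvPolynomial.X ⟨1⟩ ^ 2 + 2 * MvPolynomial.X ⟨0⟩ * MvPolynomial.X ⟨1⟩ + 2 * MvPolynomial.C a
  obtain ⟨D, hD⟩ := exists_derivation_fractionField (L := L) (MvPolynomial.mkDerivation ℂ s)
  let v : Fin 2 → L := fun i ↦ algebraMap A L (MvPolynomial.X ⟨i⟩)
  have hv : AlgebraicIndependent ℂ ![v 0, v 1] := by
    have h1 : AlgebraicIndependent ℂ v :=
      ((MvPolynomial.algebraicIndependent_X σ ℂ).map' (f := Algebra.algHom ℂ A L)
        (IsFractionRing.injective A L)).comp ULift.up ULift.up_injective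
    convert h1 using 1
    ext i
    fin_cases i <;> rfl
  have ht : D (v 0) = 1 :=
    (hD _).trans (by rw [MvPolynomial.mkDerivation_X]; exact map_one _)
  refine ⟨L, inferInstance, inferInstance, D, v 0, v 1, ℂ⟮v 0⟯.toSubfield, ht,
    fun c ↦ ℂ⟮v 0⟯.algebraMap_mem c, mem_adjoin_simple_self ℂ _, fun x hx ↦ ?_,
    ((algebraicIndependent_pair_iff _ _).1 hv).2, ?_⟩
  · induction hx using adjoin_induction with
    | mem x hx =>
      rw [Set.mem_singleton_iff.1 hx, ht]
      exact one_mem _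
    | algebraMap c =>
      rw [D.map_algebraMap]
      exact zero_mem _
    | add x y hx hy h1 h2 =>
      rw [map_add]
      exact add_mem h1 h2
    | inv x hx h1 =>
      rw [Derivation.leibniz_inv, smul_eq_mul]
      exact mul_mem (neg_mem (pow_mem (inv_mem hx) 2)) h1
    | mul x y hx hy h1 h2 =>
      rw [Derivation.leibniz]
      exact add_mem (mul_mem hx h2) (mul_mem hy h1)
  · have : D (v 1) = algebraMap A L (s ⟨1⟩) :=
      (hD _).trans (by rw [MvPolynomial.mkDerivation_X])
    rw [this]
    have hs : s ⟨1⟩ = -MvPolynomial.X ⟨1⟩ ^ 2 + 2 * MvPolynomial.X ⟨0⟩ * MvPolynomial.X ⟨1⟩ +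
      2 * MvPolynomial.C a := rfl
    rw [hs]
    simp only [map_add, map_mul, map_neg, map_pow, map_ofNat]
    rfl

end RiccatiSolutions

/-- Integral parameters admit solutions of transcendence degree one. -/
lemma exists_hasSolution.{u} {α₀ α₁ α₂ : ℂ} (hsum : α₀ + α₁ + α₂ = 1)
    (h : (∃ n : ℤ, α₀ = n) ∨ (∃ n : ℤ, α₁ = n) ∨ ∃ n : ℤ, α₂ = n) :
    ∃ (L : Type u) (_ : Field L) (_ : Algebra ℂ L) (D : Derivation ℂ L L) (t z : L)
      (K : Subfield L), D t = 1 ∧ (∀ c, algebraMap ℂ L c ∈ K) ∧ t ∈ K ∧ (∀ x ∈ K, D x ∈ K) ∧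
        HasSolution D t (algebraicClosure K L).toSubfield (algebraicClosure K⟮z⟯ L).toSubfield
          α₀ α₁ α₂ := by
  wlog h1 : ∃ n : ℤ, α₁ = n generalizing α₀ α₁ α₂
  · rcases h with h | h | h
    · obtain ⟨L, i1, i2, D, t, z, K, hDt, hK, htK, hDK, hsol⟩ :=
        this (α₀ := α₂) (α₁ := α₀) (α₂ := α₁) (by linear_combination hsum) (by tauto) h
      exact ⟨L, i1, i2, D, t, z, K, hDt, hK, htK, hDK, hsol.rotate⟩
    · exact absurd h h1
    · obtain ⟨L, i1, i2, D, t, z, K, hDt, hK, htK, hDK, hsol⟩ :=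
        this (α₀ := α₁) (α₁ := α₂) (α₂ := α₀) (by linear_combination hsum) (by tauto) h
      exact ⟨L, i1, i2, D, t, z, K, hDt, hK, htK, hDK, hsol.rotate.rotate⟩
  obtain ⟨n, rfl⟩ := h1
  obtain ⟨L, i1, i2, D, t, z, K, hDt, hK, htK, hDK, hz, hDz⟩ := exists_riccati_solution.{u} α₂
  refine ⟨L, i1, i2, D, t, z, K, hDt, hK, htK, hDK, ?_⟩
  have hsol : HasSolution D t (algebraicClosure K L).toSubfield
      (algebraicClosure K⟮z⟯ L).toSubfield (α₀ + n) 0 α₂ := by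
    have hzN : z ∈ (algebraicClosure K⟮z⟯ L).toSubfield :=
      (algebraicClosure K⟮z⟯ L).algebraMap_mem ⟨z, mem_adjoin_simple_self K z⟩
    have htM : t ∈ (algebraicClosure K L).toSubfield :=
      (algebraicClosure K L).algebraMap_mem ⟨t, htK⟩
    have h2t := add_mem htM htM
    rw [← two_mul] at h2t
    refine ⟨2 * t - z, 0, z, ?_, ⟨sub_mem
      (algebraicClosure_le_algebraicClosure_adjoin z h2t) hzN, zero_mem _, hzN⟩,
      fun h ↦ hz (mem_algebraicClosure_iff.1 h.2.2)⟩
    have hs := congrArg (algebraMap ℂ L) hsum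
    simp only [map_add, map_one] at hs
    have ht : D (2 * t) = 2 := by
      rw [two_mul, map_add, hDt, one_add_one_eq_two]
    constructor
    · linear_combination hsum
    · ring
    · rw [map_sub, ht, hDz, map_add]
      linear_combination (-2) * hs
    · simp
    · rw [hDz]
      ring
  have h3 := hsol.shift_int (algebraMap_mem_algebraicClosure hK)
    (algebraicClosure_le_algebraicClosure_adjoin z) n
  simpa using h3

/-- For nonintegral parameters, solutions are algebraic or algebraically independent. -/
lemma isAlgebraic_or_algebraicIndependent {L : Type*} [Field L] [Algebra ℂ L]
    {D : Derivation ℂ L L} {t : L} (hDt : D t = 1) {K : Subfield L}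
    (hK : ∀ c, algebraMap ℂ L c ∈ K) (htK : t ∈ K) (hDK : ∀ a ∈ K, D a ∈ K) {α₀ α₁ α₂ : ℂ}
    (h0 : ¬ ∃ n : ℤ, α₀ = n) (h1 : ¬ ∃ n : ℤ, α₁ = n) (h2 : ¬ ∃ n : ℤ, α₂ = n) {y x : L}
    (h : IsSolution D t α₀ α₁ α₂ (2 * t + y - x) (-y) x) :
    (IsAlgebraic K y ∧ IsAlgebraic K x) ∨ AlgebraicIndependent K ![y, x] := by
  by_contra hc
  rw [not_or, not_and_or] at hc
  obtain ⟨z, hz, hy, hx⟩ : ∃ z, (z = y ∨ z = x) ∧ IsAlgebraic K⟮z⟯ y ∧ IsAlgebraic K⟮z⟯ x := by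
    rcases hc.1 with hy | hx
    · exact ⟨y, .inl rfl, isAlgebraic_algebraMap (⟨y, mem_adjoin_simple_self K y⟩ : K⟮y⟯),
        isAlgebraic_adjoin_of_not_algebraicIndependent hy hc.2⟩
    · exact ⟨x, .inr rfl, isAlgebraic_adjoin_of_not_algebraicIndependent hx
          fun h ↦ hc.2 (algebraicIndependent_pair_swap h),
        isAlgebraic_algebraMap (⟨x, mem_adjoin_simple_self K x⟩ : K⟮x⟯)⟩
  have hyN : y ∈ (algebraicClosure K⟮z⟯ L).toSubfield := mem_algebraicClosure_iff.2 hy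
  have hxN : x ∈ (algebraicClosure K⟮z⟯ L).toSubfield := mem_algebraicClosure_iff.2 hx
  have htN : t ∈ (algebraicClosure K⟮z⟯ L).toSubfield :=
    algebraicClosure_le_algebraicClosure_adjoin z ((algebraicClosure K L).algebraMap_mem ⟨t, htK⟩)
  have hsol : HasSolution D t (algebraicClosure K L).toSubfield
      (algebraicClosure K⟮z⟯ L).toSubfield α₀ α₁ α₂ := by
    refine ⟨_, _, _, h, ⟨?_, neg_mem hyN, hxN⟩, fun hM ↦ ?_⟩
    · rw [two_mul]
      exact sub_mem (add_mem (add_mem htN htN) hyN) hxN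
    · have hyM := mem_algebraicClosure_iff.1 (neg_mem hM.2.1)
      rw [neg_neg] at hyM
      exact hc.1.elim (fun h ↦ h hyM) fun h ↦ h (mem_algebraicClosure_iff.1 hM.2.2)
  rcases hsol.exists_int hK htK hDK hDt with h | h | h
  exacts [h0 h, h1 h, h2 h]

/-- For integral parameters, the dichotomy fails. -/
lemma exists_not_isAlgebraic_not_algebraicIndependent.{u} {α₀ α₁ α₂ : ℂ}
    (hsum : α₀ + α₁ + α₂ = 1)
    (h : (∃ n : ℤ, α₀ = n) ∨ (∃ n : ℤ, α₁ = n) ∨ ∃ n : ℤ, α₂ = n) :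
    ∃ (L : Type u) (_ : Field L) (_ : Algebra ℂ L) (D : Derivation ℂ L L) (t y x : L)
      (K : Subfield L), D t = 1 ∧ (∀ c, algebraMap ℂ L c ∈ K) ∧ t ∈ K ∧ (∀ a ∈ K, D a ∈ K) ∧
        IsSolution D t α₀ α₁ α₂ (2 * t + y - x) (-y) x ∧
        ¬ ((IsAlgebraic K y ∧ IsAlgebraic K x) ∨ AlgebraicIndependent K ![y, x]) := by
  obtain ⟨L, i1, i2, D, t, z, K, hDt, hK, htK, hDK, f₀, f₁, f₂, hf, ⟨-, g1, g2⟩, hne⟩ :=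
    exists_hasSolution.{u} hsum h
  obtain rfl : f₀ = 2 * t + -f₁ - f₂ := by
    linear_combination hf.sum
  refine ⟨L, i1, i2, D, t, -f₁, f₂, K, hDt, hK, htK, hDK, by rwa [neg_neg], ?_⟩
  rintro (⟨hy, hx⟩ | hi)
  · have htM : t ∈ (algebraicClosure K L).toSubfield :=
      (algebraicClosure K L).algebraMap_mem ⟨t, htK⟩
    have hyM : -f₁ ∈ (algebraicClosure K L).toSubfield := mem_algebraicClosure_iff.2 hy
    have hxM : f₂ ∈ (algebraicClosure K L).toSubfield := mem_algebraicClosure_iff.2 hx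
    refine hne ⟨?_, ?_, hxM⟩
    · rw [two_mul]
      exact sub_mem (add_mem (add_mem htM htM) hyM) hxM
    · simpa using neg_mem hyM
  · exact not_algebraicIndependent_of_isAlgebraic_adjoin
      (mem_algebraicClosure_iff.1 (neg_mem g1)) (mem_algebraicClosure_iff.1 g2) hi

end PainleveIV

/-- Corollary 3.11: the solution set of the Hamiltonian system `S_IV(v₁,v₂,v₃)`
(Hamiltonian form of the fourth Painlevé equation, with `v₁ + v₂ + v₃ = 0`) is strongly
minimal (expressed via the dichotomy on solutions `(y,x)`) if and only if none of
`v₁ − v₂`, `v₂ − v₃`, `v₃ − v₁` is an integer. -/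
theorem painleveIV_system_strongly_minimal_iff
    (v₁ v₂ v₃ : ℂ) (hsum : v₁ + v₂ + v₃ = 0) :
    (∀ (L : Type*) [Field L] [Algebra ℂ L] (D : L → L),
      (∀ a b : L, D (a + b) = D a + D b) →
      (∀ a b : L, D (a * b) = a * D b + b * D a) →
      (∀ c : ℂ, D (algebraMap ℂ L c) = 0) →
      ∀ t : L, D t = 1 →
      ∀ K : Subfield L,
        (∀ c : ℂ, algebraMap ℂ L c ∈ K) → t ∈ K → (∀ a ∈ K, D a ∈ K) →
      ∀ y x : L,
        D y = 2 * x * y - y ^ 2 - 2 * t * y + 2 * algebraMap ℂ L (v₁ - v₂) →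
        D x = 2 * x * y - x ^ 2 + 2 * t * x + 2 * algebraMap ℂ L (v₁ - v₃) →
        ((IsAlgebraic K y ∧ IsAlgebraic K x) ∨ AlgebraicIndependent K ![y, x]))
    ↔ ((¬ ∃ n : ℤ, v₁ - v₂ = (n : ℂ)) ∧ (¬ ∃ n : ℤ, v₂ - v₃ = (n : ℂ)) ∧
        (¬ ∃ n : ℤ, v₃ - v₁ = (n : ℂ))) := by
  have e0 : (∃ n : ℤ, 1 + v₃ - v₂ = (n : ℂ)) ↔ ∃ n : ℤ, v₂ - v₃ = (n : ℂ) := by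
    constructor <;>
    · rintro ⟨n, hn⟩
      refine ⟨1 - n, ?_⟩
      push_cast
      linear_combination -hn
  have e1 : (∃ n : ℤ, v₂ - v₁ = (n : ℂ)) ↔ ∃ n : ℤ, v₁ - v₂ = (n : ℂ) := by
    constructor <;>
    · rintro ⟨n, hn⟩
      refine ⟨-n, ?_⟩
      push_cast
      linear_combination -hn
  have e2 : (∃ n : ℤ, v₁ - v₃ = (n : ℂ)) ↔ ∃ n : ℤ, v₃ - v₁ = (n : ℂ) := by
    constructor <;>
    · rintro ⟨n, hn⟩
      refine ⟨-n, ?_⟩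
      push_cast
      linear_combination -hn
  rw [← e0, ← e1, ← e2]
  constructor
  · intro h
    by_contra hint
    obtain ⟨L, _, _, D, t, y, x, K, hDt, hK, htK, hDK, hsol, hne⟩ :=
      PainleveIV.exists_not_isAlgebraic_not_algebraicIndependent
        (α₀ := 1 + v₃ - v₂) (α₁ := v₂ - v₁) (α₂ := v₁ - v₃) (by ring) (by tauto)
    obtain ⟨hy, hx⟩ := (PainleveIV.isSolution_iff hDt v₁ v₂ v₃ y x).1 hsol
    exact hne (h L D (map_add D) (fun a b ↦ D.leibniz a b) D.map_algebraMap t hDt K hK htK hDK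
      y x hy hx)
  · rintro ⟨h1, h0, h2⟩ L _ _ D hadd hmul hconst t hDt K hK htK hDK y x hy hx
    let D' : Derivation ℂ L L := Derivation.mk'
      { toFun := D
        map_add' := hadd
        map_smul' := fun c a ↦ by
          rw [Algebra.smul_def, hmul, hconst, mul_zero, add_zero, RingHom.id_apply,
            Algebra.smul_def] } hmul
    exact PainleveIV.isAlgebraic_or_algebraicIndependent (D := D') hDt hK htK hDK h0 h1 h2
      ((PainleveIV.isSolution_iff (D := D') hDt v₁ v₂ v₃ y x).2 ⟨hy, hx⟩)
end

section
/- Let α, β ∈ ℂ be algebraically independent over ℚ. Let L be a differential field extension of ℂ(t) with derivation D, K a differential subfield of L, and let y ∈ L with y ≠ 0 satisfy the fourth Painlevé equation y'' = (1/(2y))(y')² + (3/2)y³ + 4ty² + 2(t² − α)y + β/y. Then either y is algebraic over K, or y and y' are algebraically independent over K. (Strong minimality part of Proposition 3.12.) -/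
section

open Polynomial

section Univariate

variable {K : Type*} [Field K]

theorem mul_derivative_pow {A : Type*} [CommRing A] (P : A[X]) (n : ℕ) :
    P * derivative (P ^ n) = (n : A[X]) * P ^ n * derivative P := by
  cases n with
  | zero => simp
  | succ j =>
    rw [derivative_pow, map_natCast, Nat.add_sub_cancel]
    ring

theorem pow_dvd_of_linear_ode {R H n l : K[X]} (x : K) (e : ℕ)
    (h : (X - C x) * n * derivative R = l * R + H) (hH : (X - C x) ^ e ∣ H)
    (hne : ∀ i < e, (i : K) * n.eval x ≠ l.eval x) : (X - C x) ^ e ∣ R := by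
  suffices ∀ i ≤ e, (X - C x) ^ i ∣ R from this e le_rfl
  intro i
  induction i with
  | zero => simp
  | succ i ih =>
    intro hi
    obtain ⟨S, rfl⟩ := ih (by omega)
    obtain ⟨T, rfl⟩ := (pow_dvd_pow (X - C x) hi).trans hH
    have hX : (X - C x : K[X]) ≠ 0 := X_sub_C_ne_zero x
    have key : (i : K[X]) * n * S - l * S = (X - C x) * (T - n * derivative S) := by
      apply mul_left_cancel₀ (pow_ne_zero i hX)
      have hpow : (X - C x) * derivative ((X - C x) ^ i) = (i : K[X]) * (X - C x) ^ i := by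
        rw [mul_derivative_pow]; simp
      rw [derivative_mul] at h
      linear_combination h - n * S * hpow
    have hev := congrArg (eval x) key
    simp only [eval_sub, eval_mul, eval_natCast, eval_X, eval_C, sub_self, zero_mul] at hev
    have hS : S.eval x = 0 := by
      have : ((i : K) * n.eval x - l.eval x) * S.eval x = 0 := by linear_combination hev
      exact (mul_eq_zero.mp this).resolve_left (sub_ne_zero.mpr (hne i (by omega)))
    obtain ⟨S', rfl⟩ := dvd_iff_isRoot.mpr hS
    exact ⟨S', by ring⟩

variable [CharZero K]

/-- Polynomials dividing the product of `X * (X + 1)` with their derivative. -/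
theorem eq_C_mul_X_pow_mul_X_add_one_pow {P l : K[X]} (hP : P ≠ 0)
    (h : 3 * X * (X + 1) * derivative P = l * P) :
    ∃ (c : K) (e a : ℕ), c ≠ 0 ∧ P = C c * (X ^ e * (X + 1) ^ a) ∧
      l = 3 * (e : K[X]) * (X + 1) + 3 * (a : K[X]) * X := by
  obtain ⟨P₁, hP₁, h₁⟩ := exists_eq_pow_rootMultiplicity_mul_and_not_dvd P hP 0
  set e := rootMultiplicity 0 P
  have hP₁0 : P₁ ≠ 0 := by rintro rfl; simp at h₁
  obtain ⟨Q, hQ, h₂⟩ := exists_eq_pow_rootMultiplicity_mul_and_not_dvd P₁ hP₁0 (-1)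
  set a := rootMultiplicity (-1) P₁
  have hQ0 : Q ≠ 0 := by rintro rfl; simp at h₂
  simp only [map_zero, sub_zero, map_neg, map_one, sub_neg_eq_add] at *
  have hX : (X : K[X]) ≠ 0 := X_ne_zero
  have hX1 : (X + 1 : K[X]) ≠ 0 := X_add_C_ne_zero 1
  have p0 : X * derivative (X ^ e : K[X]) = (e : K[X]) * X ^ e := by
    rw [mul_derivative_pow]; simp
  have p1 : (X + 1) * derivative ((X + 1) ^ a : K[X]) = (a : K[X]) * (X + 1) ^ a := by
    rw [mul_derivative_pow]; simp
  set m := l - 3 * (e : K[X]) * (X + 1) - 3 * (a : K[X]) * X with hm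
  have key : 3 * X * (X + 1) * derivative Q = m * Q := by
    apply mul_left_cancel₀ (mul_ne_zero (pow_ne_zero e hX) (pow_ne_zero a hX1))
    rw [hP₁, hQ, derivative_mul, derivative_mul] at h
    rw [hm]
    linear_combination h - 3 * (X + 1) * (X + 1) ^ a * Q * p0 - 3 * X * X ^ e * Q * p1
  have hXm : X ∣ m := by
    have : X ∣ m * Q := ⟨3 * (X + 1) * derivative Q, by rw [← key]; ring⟩
    refine (Prime.dvd_or_dvd prime_X this).resolve_right fun hd => h₁ ?_
    rw [hQ]; exact hd.mul_left _
  have hX1m : X + 1 ∣ m := by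
    have : X + 1 ∣ m * Q := ⟨3 * X * derivative Q, by rw [← key]; ring⟩
    have hpr : Prime (X + 1 : K[X]) := by
      have := prime_X_sub_C (-1 : K)
      simpa using this
    exact (hpr.dvd_or_dvd this).resolve_right h₂
  have hcop : IsCoprime (X : K[X]) (X + 1) := ⟨-1, 1, by ring⟩
  obtain ⟨m', hm'⟩ := hcop.mul_dvd hXm hX1m
  have hQ' : 3 * derivative Q = m' * Q := by
    apply mul_left_cancel₀ (mul_ne_zero hX hX1)
    rw [hm'] at key
    linear_combination key
  have h3 : (3 : K[X]) = C 3 := (map_ofNat C 3).symm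
  have hdQ : derivative Q = 0 := by
    rw [← dvd_derivative_iff]
    refine ⟨C (3⁻¹) * m', ?_⟩
    have : C (3⁻¹ : K) * 3 = 1 := by rw [h3, ← C_mul]; norm_num
    linear_combination C (3⁻¹) * hQ' - derivative Q * this
  have hm0 : m = 0 := by
    rw [hdQ] at key
    simpa [hQ0] using key.symm
  have hQC := eq_C_of_derivative_eq_zero hdQ
  refine ⟨Q.coeff 0, e, a, ?_, ?_, ?_⟩
  · intro h0; rw [h0] at hQC; exact hQ0 (by simpa using hQC)
  · rw [hP₁, hQ]; nth_rw 1 [hQC]; ring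
  · linear_combination hm0 - hm

theorem natDegree_le_of_linear_ode {T H : K[X]} {p q : ℤ} (N : ℕ) (hq : ¬ (3 : ℤ) ∣ q)
    (h : 3 * X * (X + 1) * derivative T = ((p : K[X]) + (q : K[X]) * X) * T + H)
    (hH : H.natDegree ≤ N + 1) : T.natDegree ≤ N := by
  by_contra! hN
  obtain ⟨n, hn⟩ : ∃ n, T.natDegree = n + 1 := ⟨T.natDegree - 1, by omega⟩
  have hc := congrArg (fun P => coeff P (n + 2)) h
  have hT : T.coeff (n + 2) = 0 := coeff_eq_zero_of_natDegree_lt (by omega)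
  have hH0 : H.coeff (n + 2) = 0 := coeff_eq_zero_of_natDegree_lt (by omega)
  have e1 : 3 * X * (X + 1) * derivative T
      = C 3 * (derivative T * X * X) + C 3 * (derivative T * X) := by
    rw [map_ofNat C 3]; ring
  have e2 : ((p : K[X]) + (q : K[X]) * X) * T = C (p : K) * T + C (q : K) * (T * X) := by
    simp; ring
  rw [e1, e2] at hc
  simp only [coeff_add, coeff_C_mul, coeff_mul_X, coeff_derivative, hT, hH0] at hc
  have hlead : T.coeff (n + 1) ≠ 0 := by
    rw [← hn, coeff_natDegree, leadingCoeff_ne_zero]; rintro rfl; simp at hn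
  have h3 : ((3 * (n + 1) : ℤ) : K) = (q : ℤ) := by
    apply mul_right_cancel₀ hlead
    push_cast
    linear_combination hc
  exact hq ⟨n + 1, by exact_mod_cast h3.symm⟩

theorem exists_factor_of_linear_ode {R H : K[X]} {p q : ℤ} {e a : ℕ} (N : ℕ)
    (hp : ¬ (3 : ℤ) ∣ p) (hq : ¬ (3 : ℤ) ∣ q) (hpq : ¬ (3 : ℤ) ∣ p - q)
    (h : 3 * X * (X + 1) * derivative R =
      (3 * (e : K[X]) * (X + 1) + 3 * (a : K[X]) * X + ((p : K[X]) + (q : K[X]) * X)) * R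
        + X ^ e * (X + 1) ^ a * H)
    (hH : H.natDegree ≤ N + 1) :
    ∃ T : K[X], R = X ^ e * (X + 1) ^ a * T ∧ T.natDegree ≤ N ∧
      3 * X * (X + 1) * derivative T = ((p : K[X]) + (q : K[X]) * X) * T + H := by
  have hX : (X : K[X]) ≠ 0 := X_ne_zero
  have hX1 : (X + 1 : K[X]) ≠ 0 := X_add_C_ne_zero 1
  have d0 : X ^ e ∣ R := by
    have := pow_dvd_of_linear_ode (n := 3 * (X + 1))
      (l := 3 * (e : K[X]) * (X + 1) + 3 * (a : K[X]) * X + ((p : K[X]) + (q : K[X]) * X))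
      (H := X ^ e * (X + 1) ^ a * H) (0 : K) e
      (by rw [map_zero, sub_zero]; exact Eq.trans (by ring) h) (by simp [mul_assoc]) (by
        intro i _ hi
        simp at hi
        have : ((3 * i - 3 * e : ℤ) : K) = p := by push_cast; linear_combination hi
        exact hp ⟨i - e, by rw [mul_sub]; exact_mod_cast this.symm⟩)
    simpa using this
  have d1 : (X + 1) ^ a ∣ R := by
    have := pow_dvd_of_linear_ode (n := 3 * X)
      (l := 3 * (e : K[X]) * (X + 1) + 3 * (a : K[X]) * X + ((p : K[X]) + (q : K[X]) * X))
      (H := X ^ e * (X + 1) ^ a * H) (-1 : K) a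
      (by rw [map_neg, map_one, sub_neg_eq_add]; exact Eq.trans (by ring) h) (by
        simp only [map_neg, map_one, sub_neg_eq_add]; exact ⟨X ^ e * H, by ring⟩) (by
        intro i _ hi
        simp at hi
        have : ((3 * a - 3 * i : ℤ) : K) = (p - q : ℤ) := by push_cast; linear_combination hi
        exact hpq ⟨a - i, by rw [mul_sub]; exact_mod_cast this.symm⟩)
    simpa using this
  have hcop : IsCoprime (X : K[X]) (X + 1) := ⟨-1, 1, by ring⟩
  obtain ⟨T, rfl⟩ := (hcop.pow (m := e) (n := a)).mul_dvd d0 d1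
  have p0 : X * derivative (X ^ e : K[X]) = (e : K[X]) * X ^ e := by
    rw [mul_derivative_pow]; simp
  have p1 : (X + 1) * derivative ((X + 1) ^ a : K[X]) = (a : K[X]) * (X + 1) ^ a := by
    rw [mul_derivative_pow]; simp
  have key : 3 * X * (X + 1) * derivative T = ((p : K[X]) + (q : K[X]) * X) * T + H := by
    apply mul_left_cancel₀ (mul_ne_zero (pow_ne_zero e hX) (pow_ne_zero a hX1))
    rw [derivative_mul, derivative_mul] at h
    linear_combination h - 3 * (X + 1) * (X + 1) ^ a * T * p0 - 3 * X * X ^ e * T * p1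
  exact ⟨T, rfl, natDegree_le_of_linear_ode N hq key hH, key⟩

end Univariate

/-- The derivation of `A[X]` acting on the coefficients by `δ` and vanishing on `X`. -/
noncomputable def coeffDer {A : Type*} [CommRing A] (δ : Derivation ℤ A A) :
    Derivation ℤ A[X] A[X] :=
  PolynomialModule.equivPolynomialSelf.compDer δ.mapCoeffs

theorem coeff_coeffDer {A : Type*} [CommRing A] (δ : Derivation ℤ A A) (P : A[X]) (n : ℕ) :
    (coeffDer δ P).coeff n = δ (P.coeff n) := rfl

@[simp] theorem coeffDer_C {A : Type*} [CommRing A] (δ : Derivation ℤ A A) (x : A) :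
    coeffDer δ (C x) = C (δ x) := by
  ext n
  simp [coeff_coeffDer, coeff_C, apply_ite δ]

@[simp] theorem coeffDer_X {A : Type*} [CommRing A] (δ : Derivation ℤ A A) :
    coeffDer δ X = 0 := by
  ext n
  simp [coeff_coeffDer, coeff_X, apply_ite δ]

/-- Solvability of the linear equation by a polynomial of degree two forces a relation on its
right-hand side. -/
theorem painleveIV_resonance_of_natDegree_le_two {K : Type*} [Field K] [CharZero K] {T : K[X]}
    {q₀ q₁ q₂ : K} (hT : T.natDegree ≤ 2)
    (h : 3 * X * (X + 1) * derivative T =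
      (((1 : ℤ) : K[X]) + ((5 : ℤ) : K[X]) * X) * T + (X + 1) * (C q₀ + C q₁ * X + C q₂ * X ^ 2)) :
    2 * q₀ - q₁ + 2 * q₂ = 0 := by
  have hT' : T = C (T.coeff 0) + C (T.coeff 1) * X + C (T.coeff 2) * X ^ 2 := by
    rw [T.as_sum_range_C_mul_X_pow' (n := 3) (by omega)]
    simp [Finset.sum_range_succ]
  generalize T.coeff 0 = u at hT'
  generalize T.coeff 1 = v at hT'
  generalize T.coeff 2 = w at hT'
  subst hT'
  have e0 := congrArg (eval 0) h
  have e1 := congrArg (eval (-1)) h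
  have e2 := congrArg (eval 1) h
  have e3 := congrArg (eval 2) h
  simp only [Int.cast_one, Int.cast_ofNat, derivative_add, derivative_mul, derivative_C,
    derivative_X, derivative_X_pow, eval_add, eval_mul, eval_C, eval_X, eval_pow, eval_one,
    eval_zero, eval_ofNat, Nat.cast_ofNat, map_ofNat] at e0 e1 e2 e3
  linear_combination (-3 / 2) * ((e3 - e1) / 3 - 4 / 3 * e2 + 3 * e0)

/-- If the first three equations for the coefficients of an invariant polynomial, ordered by
decreasing powers of `u`, are solvable, then the parameters satisfy an integral relation. -/
theorem painleveIV_resonance {K : Type*} [Field K] [CharZero K] (δ : Derivation ℤ K K)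
    {t θ κ g₀ : K} (ht : δ t = 1) {d : ℕ} {g₁ P₀ P₁ P₂ : K[X]} (hP₀ : P₀ ≠ 0)
    (h₀ : g₁ * P₀ = (d : K[X]) * (1 + 2 * X) * P₀ - 3 * X * (X + 1) * derivative P₀)
    (h₁ : g₁ * P₁ + C g₀ * P₀ =
      ((d : K[X]) - 1) * (1 + 2 * X) * P₁ - 3 * X * (X + 1) * derivative P₁
      + 2 * C t * (d : K[X]) * P₀ - 4 * C t * X * derivative P₀ + coeffDer δ P₀)
    (h₂ : g₁ * P₂ + C g₀ * P₁ =
      ((d : K[X]) - 2) * (1 + 2 * X) * P₂ - 3 * X * (X + 1) * derivative P₂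
      + 2 * C t * ((d : K[X]) - 1) * P₁ - 4 * C t * X * derivative P₁ + coeffDer δ P₁
      + C θ * (d : K[X]) * P₀ - (C κ + C θ * X) * derivative P₀) :
    ∃ (c : K) (e a : ℕ), c ≠ 0 ∧ P₀ = C c * (X ^ e * (X + 1) ^ a) ∧
      κ * (a - e) - 2 * a + θ * (d - e - 2 * a) = 0 := by
  obtain ⟨c, e, a, hc, hP, hl⟩ :=
    eq_C_mul_X_pow_mul_X_add_one_pow (l := (d : K[X]) * (1 + 2 * X) - g₁) hP₀
      (by linear_combination h₀)
  have p0 : X * derivative (X ^ e : K[X]) = (e : K[X]) * X ^ e := by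
    rw [mul_derivative_pow]; simp
  have p1 : (X + 1) * derivative ((X + 1) ^ a : K[X]) = (a : K[X]) * (X + 1) ^ a := by
    rw [mul_derivative_pow]; simp
  obtain rfl : g₁ = (d : K[X]) * (1 + 2 * X) - (3 * (e : K[X]) * (X + 1) + 3 * (a : K[X]) * X) := by
    linear_combination -hl
  have hdP : X * (X + 1) * derivative P₀ = ((e : K[X]) * (X + 1) + (a : K[X]) * X) * P₀ := by
    rw [hP, derivative_mul, derivative_mul, derivative_C]
    linear_combination C c * (X + 1) * (X + 1) ^ a * p0 + C c * X * X ^ e * p1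
  have hδP : coeffDer δ P₀ = C (δ c / c) * P₀ := by
    have : C (δ c / c) * C c = C (δ c) := by rw [← C_mul]; field_simp
    have hM : coeffDer δ (X ^ e * (X + 1) ^ a : K[X]) = 0 := by
      simp [Derivation.leibniz, Derivation.leibniz_pow]
    rw [hP, Derivation.leibniz, hM, coeffDer_C, smul_zero, zero_add, smul_eq_mul]
    linear_combination - X ^ e * (X + 1) ^ a * this
  set γ := δ c / c
  have h2 : (C 2 : K[X]) = 2 := map_ofNat C 2
  have h4 : (C 4 : K[X]) = 4 := map_ofNat C 4
  have hR : 3 * X * (X + 1) * derivative ((X + 1) * P₁ - 2 * C t * (a : K[X]) * P₀) =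
      (3 * (e : K[X]) * (X + 1) + 3 * (a : K[X]) * X + (((-1 : ℤ) : K[X]) + ((1 : ℤ) : K[X]) * X))
        * ((X + 1) * P₁ - 2 * C t * (a : K[X]) * P₀) + X ^ e * (X + 1) ^ a *
        (C (c * (γ + 2 * t * d - g₀ - 4 * t * e - 2 * t * a)) * (X + 1)) := by
    simp only [derivative_sub, derivative_add, derivative_mul, derivative_X, derivative_one,
      derivative_C, derivative_natCast, derivative_ofNat, C_sub, C_add, C_mul, C_eq_natCast, h2, h4]
    push_cast
    linear_combination (X + 1) * h₁ + (X + 1) * hδP - (6 * C t * (a : K[X]) + 4 * C t) * hdP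
      + (X + 1) * (C γ + 2 * C t * d - C g₀ - 4 * C t * e - 2 * C t * a) * hP
  obtain ⟨T, hT, hTd, hTe⟩ := exists_factor_of_linear_ode 0 (by norm_num) (by norm_num)
    (by norm_num) hR (by
      refine natDegree_C_mul_le _ _ |>.trans ?_
      exact (natDegree_X_add_C (1 : K)).le)
  obtain ⟨k, rfl⟩ : ∃ k, T = C k := ⟨_, eq_C_of_natDegree_le_zero hTd⟩
  have hk : k = 0 := by
    have e0 := congrArg (eval (-1)) hTe
    simp at e0
    exact e0
  have hg : g₀ = γ + 2 * t * d - 4 * t * e - 2 * t * a := by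
    have e0 := congrArg (eval 0) hTe
    simp [hk, hc] at e0
    linear_combination -e0
  have hP1 : (X + 1) * P₁ = 2 * C t * (a : K[X]) * P₀ := by
    rw [hk, map_zero, mul_zero] at hT
    linear_combination hT
  have hP1' : P₁ + (X + 1) * derivative P₁ = 2 * C t * (a : K[X]) * derivative P₀ := by
    have := congrArg derivative hP1
    simpa [derivative_mul] using this
  have hP1δ : (X + 1) * coeffDer δ P₁ = (2 * (a : K[X]) + 2 * C t * (a : K[X]) * C γ) * P₀ := by
    have h1 : coeffDer δ (2 * C t * (a : K[X])) = 2 * (a : K[X]) := by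
      have h0 : coeffDer δ (2 : K[X]) = 0 := Derivation.map_natCast (coeffDer δ) 2
      simp [Derivation.leibniz, ht, h0, mul_comm]
    have := congrArg (coeffDer δ) hP1
    rw [Derivation.leibniz, Derivation.leibniz, h1, hδP] at this
    simp only [map_add, coeffDer_X, Derivation.map_one_eq_zero, smul_eq_mul] at this
    linear_combination this
  have hR2 : 3 * X * (X + 1) * derivative
      (X * (X + 1) ^ 2 * P₂ - 2 * C t ^ 2 * (a : K[X]) * ((a : K[X]) - 1) * X * P₀) =
      (3 * (e : K[X]) * (X + 1) + 3 * (a : K[X]) * X + (((1 : ℤ) : K[X]) + ((5 : ℤ) : K[X]) * X))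
        * (X * (X + 1) ^ 2 * P₂ - 2 * C t ^ 2 * (a : K[X]) * ((a : K[X]) - 1) * X * P₀)
        + X ^ e * (X + 1) ^ a * ((X + 1) * (C (-c * κ * e)
          + C (c * (2 * a + θ * d - κ * (a + e) - θ * e)) * X + C (c * θ * (d - a - e)) * X ^ 2)) := by
    rw [hg] at h₂
    simp only [derivative_sub, derivative_add, derivative_mul, derivative_X, derivative_one,
      derivative_C, derivative_natCast, derivative_ofNat, derivative_pow, C_sub, C_add, C_mul,
      C_neg, C_eq_natCast, h2, h4] at h₂ ⊢
    push_cast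
    linear_combination X * (X + 1) ^ 2 * h₂ - 4 * C t * X ^ 2 * (X + 1) * hP1' + X * (X + 1) * hP1δ
      + (-X * (X + 1) * (C γ + 2 * C t - 4 * C t * e - 2 * C t * a) + 4 * C t * X ^ 2) * hP1
      + (-6 * C t ^ 2 * a * (a - 1) * X - (C κ + C θ * X) * (X + 1) - 8 * C t ^ 2 * a * X) * hdP
      + (X + 1) * (- C κ * e + (2 * a + C θ * d - C κ * (a + e) - C θ * e) * X
        + C θ * (d - a - e) * X ^ 2) * hP
  obtain ⟨T, -, hTd, hTe⟩ := exists_factor_of_linear_ode 2 (by norm_num) (by norm_num)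
    (by norm_num) hR2 (by
      refine natDegree_mul_le_of_le (m := 1) (n := 2) ?_ ?_
      · exact (natDegree_X_add_C (1 : K)).le
      · compute_degree)
  refine ⟨c, e, a, hc, hP, ?_⟩
  have := painleveIV_resonance_of_natDegree_le_two hTd hTe
  apply mul_left_cancel₀ hc
  linear_combination this

theorem Derivation.mul_map_eq_of_generators {K B : Type*} [CommRing K] [CommRing B]
    (d : Derivation ℤ K[X][X] K[X][X]) {d' : B → B} (hd'_add : ∀ x y, d' (x + y) = d' x + d' y)
    (hd'_mul : ∀ x y, d' (x * y) = x * d' y + y * d' x) (φ : K[X][X] →+* B) (b : B)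
    (hC : ∀ k, b * φ (d (C (C k))) = d' (φ (C (C k))))
    (hCX : b * φ (d (C X)) = d' (φ (C X))) (hX : b * φ (d X) = d' (φ X)) (F : K[X][X]) :
    b * φ (d F) = d' (φ F) := by
  have hmul : ∀ P Q, b * φ (d P) = d' (φ P) → b * φ (d Q) = d' (φ Q) →
      b * φ (d (P * Q)) = d' (φ (P * Q)) := by
    intro P Q hP hQ
    rw [Derivation.leibniz, map_mul φ P Q, hd'_mul, map_add, ← hP, ← hQ]
    simp only [smul_eq_mul, map_mul]
    ring
  have hadd : ∀ P Q, b * φ (d P) = d' (φ P) → b * φ (d Q) = d' (φ Q) →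
      b * φ (d (P + Q)) = d' (φ (P + Q)) := by
    intro P Q hP hQ
    rw [map_add d, map_add φ, map_add φ, mul_add, hP, hQ, hd'_add]
  have hCp : ∀ p : K[X], b * φ (d (C p)) = d' (φ (C p)) := by
    intro p
    induction p using Polynomial.induction_on with
    | C a => exact hC a
    | add p q hp hq => rw [C_add]; exact hadd _ _ hp hq
    | monomial n a h =>
      rw [pow_succ, ← mul_assoc, C_mul]
      exact hmul _ _ h hCX
  induction F using Polynomial.induction_on with
  | C a => exact hCp a
  | add p q hp hq => exact hadd _ _ hp hq
  | monomial n a h =>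
    rw [pow_succ, ← mul_assoc]
    exact hmul _ _ h hX

/-- The derivation of `A[X][Y]` which acts on `A` as `k • δ` and maps `X` to `p`, `Y` to `q`. -/
noncomputable def bivariateDer {A : Type*} [CommRing A] (δ : Derivation ℤ A A) (k p q : A[X][X]) :
    Derivation ℤ A[X][X] A[X][X] :=
  k • coeffDer (coeffDer δ) + p • coeffDer (derivative'.restrictScalars ℤ)
    + q • derivative'.restrictScalars ℤ

section

variable {A : Type*} [CommRing A] (δ : Derivation ℤ A A) (k p q : A[X][X])

theorem bivariateDer_apply (F : A[X][X]) : bivariateDer δ k p q F =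
    k * coeffDer (coeffDer δ) F + p * coeffDer (derivative'.restrictScalars ℤ) F
      + q * derivative F := rfl

theorem bivariateDer_C_C (a : A) : bivariateDer δ k p q (C (C a)) = k * C (C (δ a)) := by
  have h₁ : coeffDer (coeffDer δ) (C (C a)) = C (C (δ a)) :=
    (coeffDer_C _ _).trans (congrArg C (coeffDer_C _ _))
  have h₂ : coeffDer (derivative'.restrictScalars ℤ) (C (C a)) = 0 :=
    (coeffDer_C _ _).trans ((congrArg C derivative_C).trans C_0)
  rw [bivariateDer_apply, h₁, h₂, derivative_C, mul_zero, mul_zero, add_zero, add_zero]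

theorem bivariateDer_C_X : bivariateDer δ k p q (C X) = p := by
  have h₁ : coeffDer (coeffDer δ) (C X) = 0 :=
    (coeffDer_C _ _).trans ((congrArg C (coeffDer_X _)).trans C_0)
  have h₂ : coeffDer (derivative'.restrictScalars ℤ) (C X : A[X][X]) = 1 :=
    (coeffDer_C _ _).trans ((congrArg C derivative_X).trans C_1)
  rw [bivariateDer_apply, h₁, h₂, derivative_C, mul_zero, mul_zero, mul_one, zero_add, add_zero]

theorem bivariateDer_X : bivariateDer δ k p q X = q := by
  have h₁ : coeffDer (coeffDer δ) X = 0 := coeffDer_X _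
  have h₂ : coeffDer (derivative'.restrictScalars ℤ) (X : A[X][X]) = 0 := coeffDer_X _
  rw [bivariateDer_apply, h₁, h₂, derivative_X, mul_zero, mul_zero, mul_one, zero_add, zero_add]

end

/-- The substitution `X ↦ Y`, `Y ↦ X * Y` on bivariate polynomials. -/
noncomputable def blowup (A : Type*) [CommRing A] : A[X][X] →+* A[X][X] :=
  eval₂RingHom (mapRingHom C) (C X * X)

section

variable {A : Type*} [CommRing A]

@[simp] theorem blowup_C (p : A[X]) : blowup A (C p) = p.map C := by simp [blowup]

@[simp] theorem blowup_X : blowup A X = C X * X := by simp [blowup]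

theorem coeff_coeff_blowup (F : A[X][X]) (n j : ℕ) :
    ((blowup A F).coeff n).coeff j = if j ≤ n then (F.coeff j).coeff (n - j) else 0 := by
  induction F using Polynomial.induction_on' with
  | add P Q hP hQ =>
    rw [map_add, coeff_add, coeff_add, hP, hQ, coeff_add, coeff_add]
    split_ifs <;> simp
  | monomial i p =>
    rw [← C_mul_X_pow_eq_monomial, map_mul, map_pow, blowup_C, blowup_X, mul_pow, ← mul_assoc,
      coeff_mul_X_pow', ← C_pow, coeff_C_mul_X_pow]
    rcases le_or_gt i n with hin | hin
    · rw [if_pos hin, coeff_mul_C, coeff_map, coeff_C_mul, coeff_X_pow]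
      rcases eq_or_ne j i with rfl | hij
      · simp [hin]
      · simp [hij]
    · rw [if_neg (by omega)]
      split_ifs <;> first | omega | simp

theorem blowup_injective : Function.Injective (blowup A) := by
  rw [injective_iff_map_eq_zero]
  intro F hF
  ext j i
  have := coeff_coeff_blowup F (i + j) j
  simpa [hF] using this.symm

theorem coeff_zero_blowup (F : A[X][X]) : (blowup A F).coeff 0 = C ((F.coeff 0).coeff 0) := by
  ext j
  rw [coeff_coeff_blowup, coeff_C]
  rcases j with _ | j <;> simp

end

section

variable {K : Type*} [Field K] (δ : Derivation ℤ K K) (t θ κ : K)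

/-- The vector field `u' = u (u + 2 v + 2 t) + θ`, `v' = - v (v + 2 u + 2 t) - κ`. -/
noncomputable def painleveIVDer : Derivation ℤ K[X][X] K[X][X] :=
  bivariateDer δ 1 (C X * (C X + 2 * X + 2 * C (C t)) + C (C θ))
    (-X * (X + 2 * C X + 2 * C (C t)) - C (C κ))

/-- The vector field `painleveIVDer` multiplied by `u`, in the coordinates `s = v / u` and `u`. -/
noncomputable def painleveIVBlowupDer : Derivation ℤ K[X][X] K[X][X] :=
  bivariateDer δ X
    (C (-3 * X * (X + 1)) * X ^ 2 - C (4 * C t * X) * X - C (C κ + C θ * X))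
    (X * (C (1 + 2 * X) * X ^ 2 + C (2 * C t) * X + C (C θ)))

theorem X_mul_blowup_painleveIVDer (F : K[X][X]) :
    X * blowup K (painleveIVDer δ t θ κ F) = painleveIVBlowupDer δ t θ κ (blowup K F) := by
  apply Derivation.mul_map_eq_of_generators _ (map_add _) fun x y => Derivation.leibniz _ x y
  · intro k
    rw [painleveIVDer, painleveIVBlowupDer, bivariateDer_C_C, one_mul, blowup_C, blowup_C, map_C,
      map_C, bivariateDer_C_C]
  · rw [painleveIVDer, painleveIVBlowupDer, bivariateDer_C_X, blowup_C, map_X, bivariateDer_X]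
    simp only [map_add, map_mul, map_ofNat, map_one, blowup_C, blowup_X, map_C, map_X]
    ring
  · rw [painleveIVDer, painleveIVBlowupDer, bivariateDer_X, blowup_X, Derivation.leibniz,
      bivariateDer_C_X, bivariateDer_X]
    simp only [map_add, map_sub, map_neg, map_mul, map_ofNat, map_one, blowup_C, blowup_X, map_C,
      map_X, smul_eq_mul]
    ring

theorem painleveIVBlowupDer_apply (W : K[X][X]) : painleveIVBlowupDer δ t θ κ W =
    X * coeffDer (coeffDer δ) W
      + (C (1 + 2 * X) * (X * (X * (X * derivative W))) + C (2 * C t) * (X * (X * derivative W))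
        + C (C θ) * (X * derivative W))
      + (C (-3 * X * (X + 1)) * (X * (X * coeffDer (derivative'.restrictScalars ℤ) W))
        - C (4 * C t * X) * (X * coeffDer (derivative'.restrictScalars ℤ) W)
        - C (C κ + C θ * X) * coeffDer (derivative'.restrictScalars ℤ) W) := by
  rw [painleveIVBlowupDer, bivariateDer_apply]
  ring

theorem coeff_X_mul_derivative (W : K[X][X]) (n : ℕ) :
    (X * derivative W).coeff n = (n : K[X]) * W.coeff n := by
  cases n with
  | zero => simp
  | succ n => rw [coeff_X_mul, coeff_derivative]; push_cast; ring

theorem coeff_painleveIVBlowupDer (W : K[X][X]) (n : ℕ) :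
    (painleveIVBlowupDer δ t θ κ W).coeff (n + 2) =
      (n : K[X]) * (1 + 2 * X) * W.coeff n - 3 * X * (X + 1) * derivative (W.coeff n)
      + 2 * C t * ((n : K[X]) + 1) * W.coeff (n + 1) - 4 * C t * X * derivative (W.coeff (n + 1))
      + coeffDer δ (W.coeff (n + 1))
      + C θ * ((n : K[X]) + 2) * W.coeff (n + 2)
      - (C κ + C θ * X) * derivative (W.coeff (n + 2)) := by
  have hN := coeff_X_mul_derivative W
  have hS : ∀ m, (coeffDer (derivative'.restrictScalars ℤ) W).coeff m = derivative (W.coeff m) :=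
    fun _ => rfl
  have hT : ∀ m, (coeffDer (coeffDer δ) W).coeff m = coeffDer δ (W.coeff m) := fun _ => rfl
  rw [painleveIVBlowupDer_apply]
  generalize X * derivative W = N at hN
  generalize coeffDer (derivative'.restrictScalars ℤ) W = S at hS
  generalize coeffDer (coeffDer δ) W = T at hT
  simp only [coeff_add, coeff_sub, coeff_C_mul, coeff_X_mul, hN, hS, hT]
  push_cast
  ring

theorem coeff_one_painleveIVBlowupDer (W : K[X][X]) :
    (painleveIVBlowupDer δ t θ κ W).coeff 1 =
      - 4 * C t * X * derivative (W.coeff 0) + coeffDer δ (W.coeff 0)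
      + C θ * W.coeff 1 - (C κ + C θ * X) * derivative (W.coeff 1) := by
  have hN := coeff_X_mul_derivative W
  have hS : ∀ m, (coeffDer (derivative'.restrictScalars ℤ) W).coeff m = derivative (W.coeff m) :=
    fun _ => rfl
  have hT : ∀ m, (coeffDer (coeffDer δ) W).coeff m = coeffDer δ (W.coeff m) := fun _ => rfl
  rw [painleveIVBlowupDer_apply]
  generalize X * derivative W = N at hN
  generalize coeffDer (derivative'.restrictScalars ℤ) W = S at hS
  generalize coeffDer (coeffDer δ) W = T at hT
  simp only [coeff_add, coeff_sub, coeff_C_mul, coeff_X_mul _ 0, coeff_X_mul_zero, hN, hS, hT]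
  push_cast
  ring

theorem coeff_zero_painleveIVBlowupDer (W : K[X][X]) :
    (painleveIVBlowupDer δ t θ κ W).coeff 0 = - (C κ + C θ * X) * derivative (W.coeff 0) := by
  have hN := coeff_X_mul_derivative W
  have hS : ∀ m, (coeffDer (derivative'.restrictScalars ℤ) W).coeff m = derivative (W.coeff m) :=
    fun _ => rfl
  rw [painleveIVBlowupDer_apply]
  generalize X * derivative W = N at hN
  generalize coeffDer (derivative'.restrictScalars ℤ) W = S at hS
  simp only [coeff_add, coeff_sub, coeff_C_mul, coeff_X_mul_zero, hN, hS]
  push_cast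
  ring

variable [CharZero K]

/-- The planar Painlevé IV system has no invariant algebraic curve for generic parameters. -/
theorem eq_C_C_of_dvd_painleveIVDer (ht : δ t = 1)
    (hgen : ∀ a e d : ℕ, κ * (a - e) - 2 * a + θ * (d - e - 2 * a) = 0 → a = 0 ∧ e = 0 ∧ d = 0)
    {F : K[X][X]} (hF : F ≠ 0) (hdvd : F ∣ painleveIVDer δ t θ κ F) :
    ∃ c : K, c ≠ 0 ∧ F = C (C c) := by
  obtain ⟨G, hG⟩ := hdvd
  have hE := X_mul_blowup_painleveIVDer δ t θ κ F
  rw [hG, map_mul] at hE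
  have hW : blowup K F ≠ 0 := (map_ne_zero_iff _ blowup_injective).mpr hF
  have hG0 := coeff_zero_blowup G
  generalize (G.coeff 0).coeff 0 = g₀ at hG0
  generalize hWdef : blowup K F = W at hE hW
  generalize blowup K G = Γ at hE hG0
  obtain ⟨d, hd⟩ : ∃ d, W.natDegree = d := ⟨_, rfl⟩
  have hlt : ∀ n, d < n → W.coeff n = 0 := fun n hn =>
    coeff_eq_zero_of_natDegree_lt (hd ▸ hn)
  have hP₀ : W.coeff d ≠ 0 := by rw [← hd]; simpa using hW
  have hdeg : (painleveIVBlowupDer δ t θ κ W).natDegree ≤ d + 2 := by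
    rw [natDegree_le_iff_coeff_eq_zero]
    intro N hN
    obtain ⟨n, rfl⟩ : ∃ n, N = n + 2 := ⟨N - 2, by omega⟩
    simp [coeff_painleveIVBlowupDer, hlt n (by omega), hlt (n + 1) (by omega),
      hlt (n + 2) (by omega)]
  have hΓ : Γ.natDegree ≤ 1 := by
    rcases eq_or_ne Γ 0 with rfl | hΓ0
    · simp
    rw [← hE, natDegree_X_mul (mul_ne_zero hW hΓ0), natDegree_mul hW hΓ0] at hdeg
    omega
  have hΓ' := eq_X_add_C_of_natDegree_le_one hΓ
  rw [hG0] at hΓ'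
  generalize Γ.coeff 1 = g₁ at hΓ'
  have hE' : C g₁ * (X * (X * W)) + C (C g₀) * (X * W) = painleveIVBlowupDer δ t θ κ W := by
    rw [← hE, hΓ']; ring
  have k₂ : ∀ n, g₁ * W.coeff n + C g₀ * W.coeff (n + 1) =
      (painleveIVBlowupDer δ t θ κ W).coeff (n + 2) := by
    intro n
    rw [← hE', coeff_add, coeff_C_mul, coeff_C_mul, coeff_X_mul, coeff_X_mul, coeff_X_mul]
  have k₁ : C g₀ * W.coeff 0 = (painleveIVBlowupDer δ t θ κ W).coeff 1 := by
    rw [← hE', coeff_add, coeff_C_mul, coeff_C_mul, coeff_X_mul _ 0, coeff_X_mul _ 0]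
    simp
  have k₀ : 0 = (painleveIVBlowupDer δ t θ κ W).coeff 0 := by
    rw [← hE']; simp
  simp only [coeff_painleveIVBlowupDer] at k₂
  rw [coeff_one_painleveIVBlowupDer] at k₁
  rw [coeff_zero_painleveIVBlowupDer] at k₀
  obtain ⟨P₁, P₂, h₁, h₂⟩ : ∃ P₁ P₂ : K[X],
      (g₁ * P₁ + C g₀ * W.coeff d = ((d : K[X]) - 1) * (1 + 2 * X) * P₁
        - 3 * X * (X + 1) * derivative P₁ + 2 * C t * (d : K[X]) * W.coeff d
        - 4 * C t * X * derivative (W.coeff d) + coeffDer δ (W.coeff d)) ∧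
      (g₁ * P₂ + C g₀ * P₁ = ((d : K[X]) - 2) * (1 + 2 * X) * P₂
        - 3 * X * (X + 1) * derivative P₂ + 2 * C t * ((d : K[X]) - 1) * P₁
        - 4 * C t * X * derivative P₁ + coeffDer δ P₁ + C θ * (d : K[X]) * W.coeff d
        - (C κ + C θ * X) * derivative (W.coeff d)) := by
    rcases d with _ | _ | n
    · refine ⟨0, 0, ?_, ?_⟩
      · rw [hlt 1 (by omega)] at k₁
        simp only [map_zero, Nat.cast_zero] at k₁ ⊢
        linear_combination k₁
      · simp only [map_zero, Nat.cast_zero]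
        linear_combination k₀
    · refine ⟨W.coeff 0, 0, ?_, ?_⟩
      · have := k₂ 0
        rw [zero_add, zero_add, hlt 2 (by omega)] at this
        simp only [map_zero, Nat.cast_zero] at this
        push_cast
        linear_combination this
      · simp only [map_zero]
        push_cast
        linear_combination k₁
    · refine ⟨W.coeff (n + 1), W.coeff n, ?_, ?_⟩
      · have := k₂ (n + 1)
        rw [hlt (n + 1 + 2) (by omega)] at this
        simp only [map_zero] at this
        push_cast at this ⊢
        linear_combination this
      · push_cast
        linear_combination k₂ n
  have h₀ := k₂ d
  rw [hlt (d + 1) (by omega), hlt (d + 2) (by omega)] at h₀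
  obtain ⟨c, e, a, hc, hP, hres⟩ := painleveIV_resonance δ ht hP₀
    (by simp only [map_zero] at h₀; linear_combination h₀) h₁ h₂
  obtain ⟨rfl, rfl, rfl⟩ := hgen a e d hres
  refine ⟨c, hc, blowup_injective (hWdef.trans ?_)⟩
  rw [eq_C_of_natDegree_eq_zero hd, hP]
  simp

end

theorem exists_forall_dvd_of_map_eq_zero {R L : Type*} [CommRing R] [IsDomain R]
    [UniqueFactorizationMonoid R] [Field L] (φ : R[X] →+* L)
    (hφ : Function.Injective (φ.comp C)) {F₀ : R[X]} (hF₀ : F₀ ≠ 0) (h₀ : φ F₀ = 0) :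
    ∃ F, F ≠ 0 ∧ φ F = 0 ∧ ∀ H, φ H = 0 → F ∣ H := by
  obtain ⟨F, hF, hprime⟩ := (RingHom.ker_isPrime φ).exists_mem_prime_of_ne_bot
    (fun h => hF₀ (by rw [← Ideal.mem_bot, ← h]; exact h₀))
  rw [RingHom.mem_ker] at hF
  refine ⟨F, hprime.ne_zero, hF, fun H hH => ?_⟩
  have hdeg : F.natDegree ≠ 0 := by
    intro h
    rw [eq_C_of_natDegree_eq_zero h] at hF
    have := (map_eq_zero_iff (φ.comp C) hφ).mp hF
    apply hprime.ne_zero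
    rw [eq_C_of_natDegree_eq_zero h, this, C_0]
  have hprim := hprime.irreducible.isPrimitive hdeg
  let := UniqueFactorizationMonoid.toGCDMonoid R
  have hirr := (hprim.irreducible_iff_irreducible_map_fraction_map
    (K := FractionRing R)).mp hprime.irreducible
  rcases EuclideanDomain.dvd_or_coprime _ (H.map (algebraMap R (FractionRing R))) hirr with
    hdvd | ⟨a, b, hab⟩
  · exact hprim.dvd_of_fraction_map_dvd_fraction_map hdvd
  · have hev : ∀ P : R[X], (P.map (algebraMap R (FractionRing R))).eval₂
        (IsFractionRing.lift hφ) (φ X) = φ P := by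
      intro P
      have hc : (IsFractionRing.lift (K := FractionRing R) hφ).comp (algebraMap R _) = φ.comp C :=
        RingHom.ext fun x => IsFractionRing.lift_algebraMap hφ x
      rw [eval₂_map, hc, ← coe_eval₂RingHom]
      congr 1
      ext <;> simp
    have := congrArg (eval₂ (IsFractionRing.lift hφ) (φ X)) hab
    rw [eval₂_add, eval₂_mul, eval₂_mul, hev, hev, hF, hH, eval₂_one] at this
    simp at this

theorem eq_zero_of_aevalAeval_eq_zero_of_painleveIV {K L : Type*} [Field K] [CharZero K] [Field L]
    [Algebra K L] (δ : Derivation ℤ K K) {D : L → L} (hD_add : ∀ x y, D (x + y) = D x + D y)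
    (hD_mul : ∀ x y, D (x * y) = x * D y + y * D x)
    (hδ : ∀ a, algebraMap K L (δ a) = D (algebraMap K L a)) {t θ κ : K} (ht : δ t = 1)
    (hgen : ∀ a e d : ℕ, κ * (a - e) - 2 * a + θ * (d - e - 2 * a) = 0 → a = 0 ∧ e = 0 ∧ d = 0)
    {u v : L} (hu : D u = u * (u + 2 * v + 2 * algebraMap K L t) + algebraMap K L θ)
    (hv : D v = -v * (v + 2 * u + 2 * algebraMap K L t) - algebraMap K L κ)
    (htr : Transcendental K u) {F₀ : K[X][X]} (h₀ : aevalAeval u v F₀ = 0) : F₀ = 0 := by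
  by_contra hF₀
  obtain ⟨φ, hφ, hφC, hφX, hφY⟩ : ∃ φ : K[X][X] →+* L, (∀ F, φ F = aevalAeval u v F) ∧
      (∀ k, φ (C (C k)) = algebraMap K L k) ∧ φ (C X) = u ∧ φ X = v :=
    ⟨(aevalAeval u v : K[X][X] →ₐ[K] L).toRingHom, fun _ => rfl, by simp, by simp, by simp⟩
  obtain ⟨F, hF, hzero, hdvd⟩ := exists_forall_dvd_of_map_eq_zero φ
    (by
      rw [injective_iff_map_eq_zero]
      intro p hp
      exact transcendental_iff.mp htr p (by simpa [hφ] using hp)) hF₀ ((hφ F₀).trans h₀)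
  have hD := Derivation.mul_map_eq_of_generators (painleveIVDer δ t θ κ) hD_add hD_mul φ 1
    (by
      intro k
      rw [painleveIVDer, bivariateDer_C_C, one_mul, one_mul, hφC, hφC, hδ])
    (by
      rw [painleveIVDer, bivariateDer_C_X]
      simp only [map_add, map_mul, map_ofNat, hφC, hφX, hφY, hu, one_mul])
    (by
      rw [painleveIVDer, bivariateDer_X]
      simp only [map_add, map_sub, map_neg, map_mul, map_ofNat, hφC, hφX, hφY, hv, one_mul]) F
  have hD0 : D 0 = 0 := by simpa using hD_add 0 0
  rw [one_mul, hzero, hD0] at hD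
  obtain ⟨c, hc, rfl⟩ := eq_C_C_of_dvd_painleveIVDer δ t θ κ ht hgen hF (hdvd _ hD)
  rw [hφC] at hzero
  exact hc ((map_eq_zero _).mp hzero)

theorem algebraicIndependent_of_painleveIV {K L : Type*} [Field K] [CharZero K] [Field L]
    [Algebra K L] (δ : Derivation ℤ K K) {D : L → L} (hD_add : ∀ x y, D (x + y) = D x + D y)
    (hD_mul : ∀ x y, D (x * y) = x * D y + y * D x)
    (hδ : ∀ a, algebraMap K L (δ a) = D (algebraMap K L a)) {t θ κ : K} (ht : δ t = 1)
    (hgen : ∀ a e d : ℕ, κ * (a - e) - 2 * a + θ * (d - e - 2 * a) = 0 → a = 0 ∧ e = 0 ∧ d = 0)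
    {u v : L} (hu : D u = u * (u + 2 * v + 2 * algebraMap K L t) + algebraMap K L θ)
    (hv : D v = -v * (v + 2 * u + 2 * algebraMap K L t) - algebraMap K L κ)
    (htr : Transcendental K u) : AlgebraicIndependent K ![u, D u] := by
  refine algebraicIndependent_iff.mpr fun P hP => ?_
  obtain ⟨F, rfl⟩ := (Bivariate.equivMvPolynomial K).surjective P
  have hF : aevalAeval u (D u) F = 0 := by
    rw [← hP]
    have : (aevalAeval u (D u) : K[X][X] →ₐ[K] L) = (MvPolynomial.aeval ![u, D u]).comp
        (Bivariate.equivMvPolynomial K).toAlgHom := by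
      ext <;> simp
    rw [this]
    rfl
  have hq : aevalAeval u v (C X * (C X + 2 * X + 2 * C (C t)) + C (C θ) : K[X][X]) = D u := by
    simp only [map_add, map_mul, map_ofNat, aevalAeval_Y, aevalAeval_C, aeval_C, aeval_X, hu]
  have hcomp : ∀ G q : K[X][X], aevalAeval u v (G.comp q) = aevalAeval u (aevalAeval u v q) G := by
    intro G q
    induction G using Polynomial.induction_on' with
    | add P Q hP hQ => rw [add_comp, map_add, map_add, hP, hQ]
    | monomial n p =>
      rw [monomial_comp, ← C_mul_X_pow_eq_monomial, map_mul, map_mul, map_pow, map_pow,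
        aevalAeval_C, aevalAeval_C, aevalAeval_Y]
  have h := eq_zero_of_aevalAeval_eq_zero_of_painleveIV δ hD_add hD_mul hδ ht hgen hu hv htr
    ((hcomp F _).trans (hq ▸ hF))
  rcases comp_eq_zero_iff.mp h with rfl | ⟨-, h⟩
  · exact map_zero _
  · have hq' : (C X * (C X + 2 * X + 2 * C (C t)) + C (C θ) : K[X][X]) =
        C (2 * X) * X + C (X ^ 2 + 2 * C t * X + C θ) := by
      simp only [map_add, map_mul, map_pow, map_ofNat]
      ring
    rw [hq'] at h
    have h₁ := congrArg (coeff · 1) h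
    simp only [coeff_add, coeff_C_mul_X, coeff_C_succ] at h₁
    simp at h₁

theorem eq_zero_of_int_mul_add_eq_zero {α β θ : ℂ} (hind : AlgebraicIndependent ℚ ![α, β])
    (hθ : θ ^ 2 = -2 * β) {m n k : ℤ} (h : m * α + n * θ + k = 0) : m = 0 ∧ n = 0 ∧ k = 0 := by
  have hP := (algebraicIndependent_iff.mp hind)
    (((m : MvPolynomial (Fin 2) ℚ) * .X 0 + k) ^ 2 + 2 * n ^ 2 * .X 1) (by
      simp only [map_add, map_mul, map_pow, map_intCast, MvPolynomial.aeval_X, map_ofNat]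
      simp only [Matrix.cons_val_zero, Matrix.cons_val_one]
      linear_combination (m * α - n * θ + k) * h + n ^ 2 * hθ)
  have ev : ∀ x y : ℚ, (m * x + k) ^ 2 + 2 * n ^ 2 * y = 0 := by
    intro x y
    simpa using congrArg (MvPolynomial.eval ![x, y]) hP
  have hk : (k : ℚ) = 0 := by simpa using ev 0 0
  have hm : (m : ℚ) = 0 := by simpa [hk] using ev 1 0
  have hn : (n : ℚ) = 0 := by simpa [hk, hm] using ev 0 1
  exact_mod_cast And.intro hm (And.intro hn hk)

theorem eq_zero_of_painleveIV_resonance {α β θ : ℂ} (hind : AlgebraicIndependent ℚ ![α, β])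
    (hθ : θ ^ 2 = -2 * β) {a e d : ℕ}
    (h : (α + 1 + θ / 2) * (a - e) - 2 * a + θ * (d - e - 2 * a) = 0) :
    a = 0 ∧ e = 0 ∧ d = 0 := by
  obtain ⟨h₁, h₂, h₃⟩ := eq_zero_of_int_mul_add_eq_zero hind hθ
    (m := 2 * (a - e)) (n := a - e + 2 * (d - e - 2 * a)) (k := 2 * (a - e) - 4 * a) (by
      push_cast
      linear_combination 2 * h)
  omega

end

/-- Strong minimality part of Proposition 3.12: for `α, β ∈ ℂ` algebraically independent
over `ℚ`, any solution `y ≠ 0` of the fourth Painlevé equation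
`y'' = (1/(2y))(y')² + (3/2)y³ + 4ty² + 2(t² − α)y + β/y` is either algebraic over a
differential subfield `K`, or `y, y'` are algebraically independent over `K`. -/
theorem painleveIV_strongly_minimal
    (α β : ℂ) (hind : AlgebraicIndependent ℚ ![α, β])
    (L : Type*) [Field L] [Algebra ℂ L]
    (D : L → L)
    (hD_add : ∀ a b : L, D (a + b) = D a + D b)
    (hD_mul : ∀ a b : L, D (a * b) = a * D b + b * D a)
    (hD_const : ∀ c : ℂ, D (algebraMap ℂ L c) = 0)
    (t : L) (hDt : D t = 1)
    (K : Subfield L)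
    (hK_const : ∀ c : ℂ, algebraMap ℂ L c ∈ K)
    (hK_t : t ∈ K)
    (hK_D : ∀ a ∈ K, D a ∈ K)
    (y : L) (hy0 : y ≠ 0)
    (hy : D (D y) = (1 / (2 * y)) * (D y) ^ 2 + (3 / 2) * y ^ 3 + 4 * t * y ^ 2
        + 2 * (t ^ 2 - algebraMap ℂ L α) * y + algebraMap ℂ L β / y) :
    IsAlgebraic K y ∨ AlgebraicIndependent K ![y, D y] := by
  have : CharZero L := charZero_of_injective_algebraMap (algebraMap ℂ L).injective
  have h2 : (2 : L) ≠ 0 := two_ne_zero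
  obtain ⟨θ, hθ⟩ := IsAlgClosed.exists_pow_nat_eq (-2 * β) two_pos
  let ι : ℂ →+* K := (algebraMap ℂ L).codRestrict K hK_const
  let δ : Derivation ℤ K K := Derivation.mk'
    (AddMonoidHom.toIntLinearMap
      (AddMonoidHom.mk' (fun a : K => (⟨D a, hK_D a a.2⟩ : K))
        fun a b => Subtype.ext (hD_add a b)))
    fun a b => Subtype.ext (hD_mul a b)
  refine or_iff_not_imp_left.mpr fun htr => ?_
  obtain ⟨v, hv⟩ : ∃ v, v = (D y - y ^ 2 - 2 * t * y - algebraMap ℂ L θ) / (2 * y) := ⟨_, rfl⟩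
  have hu : D y = y * (y + 2 * v + 2 * t) + algebraMap ℂ L θ := by
    rw [hv]; field_simp; ring
  have hDv : D v = -v * (v + 2 * y + 2 * t) - algebraMap ℂ L (α + 1 + θ / 2) := by
    have hθL : (algebraMap ℂ L θ) ^ 2 = -2 * algebraMap ℂ L β := by
      rw [← map_pow, hθ, map_mul, map_neg, map_ofNat]
    have hD2 : D 2 = 0 := by simpa only [map_ofNat] using hD_const 2
    have h := congrArg D hu
    rw [hD_add, hD_mul, hD_add, hD_add, hD_mul 2 v, hD_mul 2 t, hD2, hDt, hD_const] at h
    rw [map_add, map_add, map_div₀, map_one, map_ofNat]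
    have hy' : 2 * y * D (D y) = D y ^ 2 + 3 * y ^ 4 + 8 * t * y ^ 3
        + 4 * (t ^ 2 - algebraMap ℂ L α) * y ^ 2 + 2 * algebraMap ℂ L β := by
      rw [hy]; field_simp; ring
    generalize D (D y) = z at h hy'
    rw [hu] at h hy'
    apply mul_left_cancel₀ (mul_ne_zero two_ne_zero (mul_ne_zero h2 (pow_ne_zero 2 hy0)))
    linear_combination hy' - 2 * y * h + hθL
  refine algebraicIndependent_of_painleveIV δ hD_add hD_mul (fun _ => rfl) (t := ⟨t, hK_t⟩)
    (θ := ι θ) (κ := ι (α + 1 + θ / 2)) (Subtype.ext hDt) (fun a e d h => ?_) hu hDv htr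
  exact eq_zero_of_painleveIV_resonance hind hθ (ι.injective (by simpa [map_ofNat ι] using h))
end
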